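/- arXiv:2307.01143 — 10 statements merged into one kernel-verified Lean document; each statement's English description precedes it below -/
import Mathlib

section
/- Let X be a T1 topological space and let P be a family of nonempty open subsets of X forming a basis for its topology, regarded as a poset under inclusion. Then every cap of P covers X, i.e. if C is a cap of P then ⋃C = X. -/
/-- `A` refines `B`: every element of `A` lies below some element of `B`. -/
def Refines {α : Type*} [PartialOrder α] (A B : Set α) : Prop :=
  ∀ a ∈ A, ∃ b ∈ B, a ≤ b

/-- A band: a finite subset such that every element of the poset is comparable with some member. -/
def IsBand {α : Type*} [PartialOrder α] (B : Set α) : Prop :=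
  B.Finite ∧ ∀ p : α, ∃ b ∈ B, p ≤ b ∨ b ≤ p

/-- A cap: a subset refined by some band. -/
def IsCap {α : Type*} [PartialOrder α] (C : Set α) : Prop :=
  ∃ B : Set α, IsBand B ∧ Refines B C

/-- A minimal cap: a cap no proper subset of which is a cap. -/
def IsMinimalCap {α : Type*} [PartialOrder α] (C : Set α) : Prop :=
  IsCap C ∧ ∀ D : Set α, D ⊂ C → ¬ IsCap D

/-- A selector: a subset meeting every cap. -/
def IsSelector {α : Type*} [PartialOrder α] (S : Set α) : Prop :=
  ∀ C : Set α, IsCap C → (S ∩ C).Nonempty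

/-- A minimal selector: a selector minimal under inclusion among selectors. -/
def IsMinSelector {α : Type*} [PartialOrder α] (S : Set α) : Prop :=
  IsSelector S ∧ ∀ T : Set α, T ⊆ S → IsSelector T → T = S

/-- An ω-poset: every principal filter is finite, and for each `n` only finitely many
principal filters have exactly `n` elements. -/
def IsOmegaPoset (α : Type*) [PartialOrder α] : Prop :=
  (∀ p : α, (Set.Ici p).Finite) ∧ ∀ n : ℕ, {p : α | (Set.Ici p).ncard = n}.Finite

/-- The rank of `p`: the length of the longest strictly increasing chain starting at `p`,
i.e. `r(p) = sup_{q > p} (r(q) + 1)`. -/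
noncomputable def chainRank {α : Type*} [PartialOrder α] (p : α) : ℕ :=
  sSup {n : ℕ | ∃ c : ℕ → α, c 0 = p ∧ ∀ i < n, c i < c (i + 1)}

/-- The `n`-th level: the minimal elements of the `n`-th cone `{p | chainRank p ≤ n}`. -/
def levelSet (α : Type*) [PartialOrder α] (n : ℕ) : Set α :=
  {p : α | chainRank p ≤ n ∧ ∀ q : α, q < p → ¬ chainRank q ≤ n}

/-- Predetermined: every non-minimal `p` has some `q < p` all of whose strict upper bounds
lie above `p`. -/
def Predetermined (α : Type*) [PartialOrder α] : Prop :=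
  ∀ p : α, ¬ IsMin p → ∃ q : α, q < p ∧ ∀ r : α, q < r → p ≤ r

/-- Branching. -/
def Branching (α : Type*) [PartialOrder α] : Prop :=
  ∀ p q : α, p < q → ∃ r : α, r < q ∧ ¬ r ≤ p ∧ ¬ p ≤ r

/-- The cap-order on elements: `p ≾ q` iff adding `q` to any family keeping `p` a cap keeps a cap. -/
def CapBelow {α : Type*} [PartialOrder α] (p q : α) : Prop :=
  ∀ F : Set α, IsCap (F ∪ {p}) → IsCap (F ∪ {q})

/-- Cap-determined: the cap-order on elements agrees with the order. -/
def CapDetermined (α : Type*) [PartialOrder α] : Prop :=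
  ∀ p q : α, CapBelow p q → p ≤ q

/-- Graded: immediate predecessors have rank exactly one more. -/
def GradedPoset (α : Type*) [PartialOrder α] : Prop :=
  ∀ p q : α, p ⋖ q → chainRank p = chainRank q + 1

/-- `Wedge p q`: `p` and `q` have a common lower bound. -/
def Wedge {α : Type*} [PartialOrder α] (p q : α) : Prop :=
  ∃ r : α, r ≤ p ∧ r ≤ q

/-- Star-below: `p ◁ q` iff there is a cap `C` with every element of the star `Cp` below `q`. -/
def StarBelow {α : Type*} [PartialOrder α] (p q : α) : Prop :=
  ∃ C : Set α, IsCap C ∧ ∀ c ∈ C, Wedge c p → c ≤ q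

/-- Regular: every cap is ◁-refined by some cap. -/
def RegularPoset (α : Type*) [PartialOrder α] : Prop :=
  ∀ C : Set α, IsCap C → ∃ D : Set α, IsCap D ∧ ∀ d ∈ D, ∃ c ∈ C, StarBelow d c

/-- Prime: for every `p` there is `F` with `F ∪ {p}` a cap but `F` not a cap. -/
def PrimePoset (α : Type*) [PartialOrder α] : Prop :=
  ∀ p : α, ∃ F : Set α, IsCap (F ∪ {p}) ∧ ¬ IsCap F

/-- Cluster: connected with respect to the common-lower-bound relation. -/
def IsCluster {α : Type*} [PartialOrder α] (C : Set α) : Prop :=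
  ∀ A B : Set α, A.Nonempty → B.Nonempty → A ∪ B = C → ∃ a ∈ A, ∃ b ∈ B, Wedge a b

/-- `D^{≤_B ≥}`: the elements sharing an upper bound in `B` with some element of `D`. -/
def SharedUpper {α : Type*} [PartialOrder α] (D B : Set α) : Set α :=
  {p : α | ∃ d ∈ D, ∃ b ∈ B, p ≤ b ∧ d ≤ b}

/-- Weakly tangled refinement. -/
def WeaklyTangledRefinement {α : Type*} [PartialOrder α] (A B : Set α) : Prop :=
  Refines A B ∧ ∀ C D : Set α, C ⊆ A → D ⊆ A → IsCluster C → IsCluster D →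
    (C ∩ D).Nonempty → C ⊆ SharedUpper D B ∨ D ⊆ SharedUpper C B

/-- Weakly tangled poset: every cap has a weakly tangled refinement which is a cap. -/
def WeaklyTangled (α : Type*) [PartialOrder α] : Prop :=
  ∀ C : Set α, IsCap C → ∃ A : Set α, IsCap A ∧ WeaklyTangledRefinement A C

/-- Injectivity of `≤` from level `n` to level `m`: every `p` in level `m` has a witness
`q` in level `n` below `p` and below no other element of level `m`. -/
def LevelInjOn (α : Type*) [PartialOrder α] (m n : ℕ) : Prop :=
  ∀ p ∈ levelSet α m, ∃ q ∈ levelSet α n,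
    q ≤ p ∧ ∀ p' ∈ levelSet α m, q ≤ p' → p' = p

/-- The spectrum: the set of minimal selectors. -/
def Spectrum (α : Type*) [PartialOrder α] : Type _ :=
  {S : Set α // IsMinSelector S}

/-- The topology on the spectrum generated by the sets `p^∈ = {S | p ∈ S}`. -/
instance {α : Type*} [PartialOrder α] : TopologicalSpace (Spectrum α) :=
  TopologicalSpace.generateFrom
    {U : Set (Spectrum α) | ∃ p : α, U = {S : Spectrum α | p ∈ S.1}}

/-- A basis of nonempty (open) sets. -/
def IsNeBasis {X : Type*} [TopologicalSpace X] (P : Set (Set X)) : Prop :=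
  TopologicalSpace.IsTopologicalBasis P ∧ ∀ p ∈ P, p.Nonempty

/-- Cap-basis: a basis of nonempty open sets whose caps (under inclusion) are exactly
the covers of the space. -/
def IsCapBasis {X : Type*} [TopologicalSpace X] (P : Set (Set X)) : Prop :=
  IsNeBasis P ∧ ∀ C : Set ↥P, (IsCap C ↔ (⋃ c ∈ C, (c : Set X)) = Set.univ)

/-- Band-basis: a basis of nonempty open sets whose bands (under inclusion) are exactly
the finite covers of the space. -/
def IsBandBasis {X : Type*} [TopologicalSpace X] (P : Set (Set X)) : Prop :=
  IsNeBasis P ∧ ∀ B : Set ↥P, (IsBand B ↔ B.Finite ∧ (⋃ b ∈ B, (b : Set X)) = Set.univ)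

/-- In a T1 space, every band of a basis of nonempty open sets covers the space: otherwise a
point `x` is missed by the band, and a basic neighbourhood of `x` avoiding one chosen point of each
band member is comparable with none of them. -/
theorem IsBand.exists_mem {X : Type*} [TopologicalSpace X] [T1Space X] {P : Set (Set X)}
    (hbasis : TopologicalSpace.IsTopologicalBasis P) (hne : ∀ p ∈ P, p.Nonempty)
    {B : Set ↥P} (hB : IsBand B) (x : X) : ∃ b ∈ B, x ∈ (b : Set X) := by
  by_contra! hx
  choose y hy using fun b : ↥P => hne b b.2
  have hxy : x ∈ (y '' B)ᶜ := by
    rintro ⟨b, hb, rfl⟩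
    exact hx b hb (hy b)
  obtain ⟨p, hp, hxp, hpy⟩ :=
    hbasis.exists_subset_of_mem_open hxy (hB.1.image y).isClosed.isOpen_compl
  obtain ⟨b, hb, hpb | hbp⟩ := hB.2 ⟨p, hp⟩
  · exact hx b hb (hpb hxp)
  · exact hpy (hbp (hy b)) ⟨b, hb, rfl⟩

/-- In a T1 space, every cap of a basis of nonempty open sets covers the space. -/
theorem caps_are_covers {X : Type*} [TopologicalSpace X] [T1Space X]
    (P : Set (Set X)) (hbasis : TopologicalSpace.IsTopologicalBasis P)
    (hne : ∀ p ∈ P, p.Nonempty)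
    (C : Set ↥P) (hC : IsCap C) :
    (⋃ c ∈ C, (c : Set X)) = Set.univ := by
  obtain ⟨B, hB, hBC⟩ := hC
  refine Set.eq_univ_of_forall fun x => ?_
  obtain ⟨b, hb, hxb⟩ := hB.exists_mem hbasis hne x
  obtain ⟨c, hc, hbc⟩ := hBC b hb
  exact Set.mem_biUnion hc (hbc hxb)
end

section
/- Every second countable compact T1 topological space has a cap-basis. -/
/-- A finite open cover in which every member contains a point lying in no other member. -/
structure IsMinCover {X : Type*} [TopologicalSpace X] (C : Set (Set X)) : Prop where
  finite : C.Finite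
  isOpen : ∀ c ∈ C, IsOpen c
  sUnion_eq : ⋃₀ C = Set.univ
  exists_private : ∀ c ∈ C, ∃ x ∈ c, ∀ d ∈ C, x ∈ d → d = c

theorem Refines.trans {α : Type*} [PartialOrder α] {A B C : Set α}
    (hAB : Refines A B) (hBC : Refines B C) : Refines A C := by
  intro a ha
  obtain ⟨b, hb, hab⟩ := hAB a ha
  obtain ⟨c, hc, hbc⟩ := hBC b hb
  exact ⟨c, hc, hab.trans hbc⟩

theorem exists_isMinCover_subset {X : Type*} [TopologicalSpace X] {A : Set (Set X)}
    (hfin : A.Finite) (hopen : ∀ a ∈ A, IsOpen a) (hcov : ⋃₀ A = Set.univ) :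
    ∃ C ⊆ A, IsMinCover C := by
  have hF : {S : Set (Set X) | S ⊆ A ∧ ⋃₀ S = Set.univ}.Finite :=
    hfin.finite_subsets.subset fun S hS => hS.1
  obtain ⟨C, ⟨hCA, hC⟩, hmin⟩ := hF.exists_minimal ⟨A, subset_rfl, hcov⟩
  refine ⟨C, hCA, hfin.subset hCA, fun c hc => hopen c (hCA hc), hC, fun c hc => ?_⟩
  have hnot : ⋃₀ (C \ {c}) ≠ Set.univ := fun h =>
    (hmin ⟨Set.sdiff_subset.trans hCA, h⟩ Set.sdiff_subset hc).2 rfl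
  obtain ⟨x, hx⟩ := (Set.ne_univ_iff_exists_notMem _).1 hnot
  have huniq : ∀ d ∈ C, x ∈ d → d = c := fun d hd hxd => by
    by_contra hne
    exact hx ⟨d, ⟨hd, hne⟩, hxd⟩
  obtain ⟨d, hd, hxd⟩ := Set.sUnion_eq_univ_iff.1 hC x
  exact ⟨x, huniq d hd hxd ▸ hxd, huniq⟩

theorem exists_isMinCover_refines {X : Type*} [TopologicalSpace X] {A B : Set (Set X)}
    (hA : A.Finite) (hAo : ∀ a ∈ A, IsOpen a) (hAc : ⋃₀ A = Set.univ)
    (hB : B.Finite) (hBo : ∀ b ∈ B, IsOpen b) (hBc : ⋃₀ B = Set.univ) :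
    ∃ C, IsMinCover C ∧ Refines C A ∧ Refines C B := by
  obtain ⟨C, hCs, hC⟩ := exists_isMinCover_subset (A := Set.image2 (· ∩ ·) A B)
    (hA.image2 _ hB)
    (by rintro _ ⟨a, ha, b, hb, rfl⟩; exact (hAo a ha).inter (hBo b hb))
    (Set.sUnion_eq_univ_iff.2 fun x => by
      obtain ⟨a, ha, hxa⟩ := Set.sUnion_eq_univ_iff.1 hAc x
      obtain ⟨b, hb, hxb⟩ := Set.sUnion_eq_univ_iff.1 hBc x
      exact ⟨a ∩ b, ⟨a, ha, b, hb, rfl⟩, hxa, hxb⟩)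
  refine ⟨C, hC, fun c hc => ?_, fun c hc => ?_⟩
  · obtain ⟨a, ha, b, hb, rfl⟩ := hCs hc
    exact ⟨a, ha, Set.inter_subset_left⟩
  · obtain ⟨a, ha, b, hb, rfl⟩ := hCs hc
    exact ⟨b, hb, Set.inter_subset_right⟩

/-- In a second countable compact space, countably many finite open covers refine all
open covers. -/
theorem exists_seq_finite_cover_refines (X : Type*) [TopologicalSpace X]
    [SecondCountableTopology X] [CompactSpace X] :
    ∃ D : ℕ → Set (Set X),
      (∀ n, (D n).Finite ∧ (∀ d ∈ D n, IsOpen d) ∧ ⋃₀ D n = Set.univ) ∧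
      ∀ A : Set (Set X), (∀ a ∈ A, IsOpen a) → ⋃₀ A = Set.univ → ∃ n, Refines (D n) A := by
  set b := TopologicalSpace.countableBasis X
  have hb := TopologicalSpace.isBasis_countableBasis X
  set F : Set (Set (Set X)) := {S | S.Finite ∧ S ⊆ b ∧ ⋃₀ S = Set.univ}
  have hF : F.Countable := by
    refine (Set.countable_ofPred_finite_subset
      (TopologicalSpace.countable_countableBasis X)).mono ?_
    exact fun S hS => ⟨hS.1, hS.2.1⟩
  have key : ∀ A : Set (Set X), (∀ a ∈ A, IsOpen a) → ⋃₀ A = Set.univ →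
      ∃ S ∈ F, Refines S A := by
    intro A hAo hAc
    obtain ⟨T, hTs, hTf, hTc⟩ := isCompact_univ.elim_finite_subcover_image
      (b := {u : Set X | u ∈ b ∧ ∃ a ∈ A, u ⊆ a}) (c := id) (fun u hu => hb.isOpen hu.1) (fun x _ => by
        obtain ⟨a, ha, hxa⟩ := Set.sUnion_eq_univ_iff.1 hAc x
        obtain ⟨u, hu, hxu, hua⟩ := hb.exists_subset_of_mem_open hxa (hAo a ha)
        exact Set.mem_biUnion (t := id) ⟨hu, a, ha, hua⟩ hxu)
    exact ⟨T, ⟨hTf, fun u hu => (hTs hu).1, by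
      rw [Set.sUnion_eq_biUnion]; exact Set.univ_subset_iff.1 hTc⟩, fun u hu => (hTs hu).2⟩
  obtain ⟨S₀, hS₀, -⟩ := key {Set.univ} (by simp) (by simp)
  obtain ⟨D, hD⟩ := hF.exists_eq_range ⟨S₀, hS₀⟩
  refine ⟨D, fun n => ?_, fun A hAo hAc => ?_⟩
  · have h : D n ∈ F := hD ▸ Set.mem_range_self n
    exact ⟨h.1, fun d hd => hb.isOpen (h.2.1 hd), h.2.2⟩
  · obtain ⟨S, hS, hSA⟩ := key A hAo hAc
    rw [hD] at hS
    obtain ⟨n, rfl⟩ := hS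
    exact ⟨n, hSA⟩

theorem exists_seq_isMinCover (X : Type*) [TopologicalSpace X]
    [SecondCountableTopology X] [CompactSpace X] :
    ∃ C : ℕ → Set (Set X), (∀ n, IsMinCover (C n)) ∧
      (∀ m n, m ≤ n → Refines (C n) (C m)) ∧
      ∀ A : Set (Set X), (∀ a ∈ A, IsOpen a) → ⋃₀ A = Set.univ → ∃ n, Refines (C n) A := by
  obtain ⟨D, hD, hDA⟩ := exists_seq_finite_cover_refines X
  have step : ∀ (n : ℕ) (A : {A : Set (Set X) // IsMinCover A}),
      ∃ B : {A : Set (Set X) // IsMinCover A}, Refines B.1 A.1 ∧ Refines B.1 (D n) := by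
    rintro n ⟨A, hA⟩
    obtain ⟨B, hB, h⟩ := exists_isMinCover_refines hA.finite hA.isOpen hA.sUnion_eq
      (hD n).1 (hD n).2.1 (hD n).2.2
    exact ⟨⟨B, hB⟩, h⟩
  choose next hnext using step
  obtain ⟨C₀, -, hC₀⟩ := exists_isMinCover_subset (hD 0).1 (hD 0).2.1 (hD 0).2.2
  let C : ℕ → {A : Set (Set X) // IsMinCover A} := fun n => Nat.rec ⟨C₀, hC₀⟩ next n
  have hC : ∀ n, Refines (C (n + 1)).1 (C n).1 ∧ Refines (C (n + 1)).1 (D n) :=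
    fun n => hnext n (C n)
  refine ⟨fun n => (C n).1, fun n => (C n).2, fun m n hmn => ?_, fun A hAo hAc => ?_⟩
  · induction n, hmn using Nat.le_induction with
    | base => exact fun a ha => ⟨a, ha, le_rfl⟩
    | succ n _ ih => exact (hC n).1.trans ih
  · obtain ⟨n, hn⟩ := hDA A hAo hAc
    exact ⟨n + 1, (hC n).2.trans hn⟩

/-- A refinement of a minimal cover has a member inside each member of the minimal cover. -/
theorem IsMinCover.exists_subset_of_refines {X : Type*} [TopologicalSpace X]
    {A B : Set (Set X)} (hB : IsMinCover B) (hA : ⋃₀ A = Set.univ) (hAB : Refines A B)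
    {b : Set X} (hb : b ∈ B) : ∃ a ∈ A, a ⊆ b := by
  obtain ⟨x, -, hx⟩ := hB.exists_private b hb
  obtain ⟨a, ha, hxa⟩ := Set.sUnion_eq_univ_iff.1 hA x
  obtain ⟨c, hc, hac⟩ := hAB a ha
  exact ⟨a, ha, hx c hc (hac hxa) ▸ hac⟩

/-- Bands of a basis of nonempty sets in a T1 space are covers. -/
theorem IsNeBasis.exists_mem_of_isBand {X : Type*} [TopologicalSpace X] [T1Space X]
    {P : Set (Set X)} (hP : IsNeBasis P) {B : Set P} (hB : IsBand B) (x : X) :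
    ∃ b ∈ B, x ∈ (b : Set X) := by
  by_contra! hx
  choose y hy using fun b : P => hP.2 b b.2
  have hopen : IsOpen (y '' B)ᶜ := (hB.1.image y).isClosed.isOpen_compl
  have hxU : x ∈ (y '' B)ᶜ := by
    rintro ⟨b, hb, rfl⟩
    exact hx b hb (hy b)
  obtain ⟨p, hp, hxp, hpU⟩ := hP.1.exists_subset_of_mem_open hxU hopen
  obtain ⟨b, hb, hpb | hbp⟩ := hB.2 ⟨p, hp⟩
  · exact hx b hb (hpb hxp)
  · exact hpU (hbp (hy b)) ⟨b, hb, rfl⟩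

/-- Every second countable compact T1 space has a cap-basis. -/
theorem exists_capBasis {X : Type*} [TopologicalSpace X]
    [SecondCountableTopology X] [CompactSpace X] [T1Space X] :
    ∃ P : Set (Set X), IsCapBasis P := by
  obtain ⟨C, hC, hmono, href⟩ := exists_seq_isMinCover X
  have hopen : ∀ p ∈ ⋃ n, C n, IsOpen p := fun p hp => by
    obtain ⟨n, hn⟩ := Set.mem_iUnion.1 hp
    exact (hC n).isOpen p hn
  have hbasis : IsNeBasis (⋃ n, C n) := by
    refine ⟨TopologicalSpace.isTopologicalBasis_of_isOpen_of_nhds hopen fun x U hxU hU => ?_,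
      fun p hp => ?_⟩
    · obtain ⟨n, hn⟩ := href {U, {x}ᶜ} (by simp [hU]) (by
        refine Set.sUnion_eq_univ_iff.2 fun y => ?_
        by_cases hy : y = x
        · exact ⟨U, by simp, hy ▸ hxU⟩
        · exact ⟨{x}ᶜ, by simp, hy⟩)
      obtain ⟨c, hc, hxc⟩ := Set.sUnion_eq_univ_iff.1 (hC n).sUnion_eq x
      obtain ⟨d, rfl | rfl, hcd⟩ := hn c hc
      · exact ⟨c, Set.mem_iUnion.2 ⟨n, hc⟩, hxc, hcd⟩
      · exact absurd rfl (hcd hxc)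
    · obtain ⟨n, hn⟩ := Set.mem_iUnion.1 hp
      obtain ⟨x, hx, -⟩ := (hC n).exists_private p hn
      exact ⟨x, hx⟩
  refine ⟨⋃ n, C n, hbasis, fun A => ⟨?_, fun hA => ?_⟩⟩
  · rintro ⟨B, hB, hBA⟩
    refine Set.eq_univ_of_forall fun x => ?_
    obtain ⟨b, hb, hxb⟩ := hbasis.exists_mem_of_isBand hB x
    obtain ⟨a, ha, hba⟩ := hBA b hb
    exact Set.mem_biUnion ha (hba hxb)
  · obtain ⟨n, hn⟩ := href (Subtype.val '' A) (by rintro _ ⟨a, -, rfl⟩; exact hopen a a.2)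
      (by rw [Set.sUnion_image]; exact hA)
    refine ⟨Subtype.val ⁻¹' C n,
      ⟨(hC n).finite.preimage Subtype.val_injective.injOn, fun p => ?_⟩, fun b hb => ?_⟩
    · obtain ⟨m, hm⟩ := Set.mem_iUnion.1 p.2
      rcases le_total m n with h | h
      · obtain ⟨c, hc, hcp⟩ :=
          (hC m).exists_subset_of_refines (hC n).sUnion_eq (hmono m n h) hm
        exact ⟨⟨c, Set.mem_iUnion.2 ⟨n, hc⟩⟩, hc, Or.inr hcp⟩
      · obtain ⟨c, hc, hpc⟩ := hmono n m h p hm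
        exact ⟨⟨c, Set.mem_iUnion.2 ⟨n, hc⟩⟩, hc, Or.inl hpc⟩
    · obtain ⟨_, ⟨a, ha, rfl⟩, hba⟩ := hn b hb
      exact ⟨a, ha, hba⟩
end

section
/- If P is an ω-poset then its levels are coinitial among its bands with respect to refinement: every level P_n is a band of P, and every band B of P is refined by some level P_n (i.e. every element of P_n is ≤ some element of B). -/
/-- The length of a strictly increasing chain is less than the size of the principal filter
at its first element. -/
theorem chain_length_lt_ncard_Ici {α : Type*} [PartialOrder α] {p : α} (hp : (Set.Ici p).Finite)
    {n : ℕ} {c : ℕ → α} (h0 : c 0 = p) (hc : ∀ i < n, c i < c (i + 1)) :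
    n < (Set.Ici p).ncard := by
  have hmono : StrictMonoOn c (Set.Iic n) :=
    strictMonoOn_Iic_of_lt_succ fun i hi => hc i hi
  have hsub : c '' Set.Iic n ⊆ Set.Ici p := by
    rintro _ ⟨i, hi, rfl⟩
    exact h0 ▸ hmono.monotoneOn (Set.mem_Iic.2 n.zero_le) hi i.zero_le
  have hle := Set.ncard_le_ncard hsub hp
  rw [hmono.injOn.ncard_image, Set.ncard_eq_toFinset_card'] at hle
  simpa using hle

theorem le_chainRank {α : Type*} [PartialOrder α] {p : α} (hp : (Set.Ici p).Finite)
    {n : ℕ} {c : ℕ → α} (h0 : c 0 = p) (hc : ∀ i < n, c i < c (i + 1)) :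
    n ≤ chainRank p :=
  le_csSup ⟨(Set.Ici p).ncard, fun _ ⟨_, h0, hc⟩ => (chain_length_lt_ncard_Ici hp h0 hc).le⟩
    ⟨c, h0, hc⟩

theorem exists_chain_length_eq_chainRank {α : Type*} [PartialOrder α] {p : α}
    (hp : (Set.Ici p).Finite) :
    ∃ c : ℕ → α, c 0 = p ∧ ∀ i < chainRank p, c i < c (i + 1) :=
  Nat.sSup_mem (s := {n : ℕ | ∃ c : ℕ → α, c 0 = p ∧ ∀ i < n, c i < c (i + 1)})
    ⟨0, fun _ => p, rfl, fun _ hi => absurd hi (Nat.not_lt_zero _)⟩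
    ⟨(Set.Ici p).ncard, fun _ ⟨_, h0, hc⟩ => (chain_length_lt_ncard_Ici hp h0 hc).le⟩

theorem chainRank_lt_of_lt {α : Type*} [PartialOrder α] {p q : α} (hp : (Set.Ici p).Finite)
    (hpq : p < q) : chainRank q < chainRank p := by
  obtain ⟨c, h0, hc⟩ := exists_chain_length_eq_chainRank
    (hp.subset (Set.Ici_subset_Ici.2 hpq.le))
  refine le_chainRank hp (c := fun i => Nat.casesOn i p c) rfl fun i hi => ?_
  cases i with
  | zero => simpa [h0] using hpq
  | succ i => exact hc i (Nat.lt_of_succ_lt_succ hi)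

theorem exists_lt_le_chainRank {α : Type*} [PartialOrder α] {p : α} (hp : (Set.Ici p).Finite)
    {n : ℕ} (hn : n < chainRank p) : ∃ q, p < q ∧ n ≤ chainRank q := by
  obtain ⟨c, h0, hc⟩ := exists_chain_length_eq_chainRank hp
  have hlt : p < c 1 := h0 ▸ hc 0 (Nat.zero_lt_of_lt hn)
  exact ⟨c 1, hlt, le_chainRank (c := fun i => c (i + 1))
    (hp.subset (Set.Ici_subset_Ici.2 hlt.le)) rfl fun i hi => hc (i + 1) (by omega)⟩

/-- Every smaller rank is attained above a given element. -/
theorem exists_ge_chainRank_eq {α : Type*} [PartialOrder α] {p : α} (hp : (Set.Ici p).Finite)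
    {n : ℕ} (hn : n ≤ chainRank p) : ∃ q, p ≤ q ∧ chainRank q = n := by
  obtain ⟨q, hq⟩ := (hp.subset (Set.sep_subset _ fun q => n ≤ chainRank q)).exists_maximal
    ⟨p, Set.mem_Ici.2 le_rfl, hn⟩
  refine ⟨q, hq.prop.1, hq.prop.2.antisymm' (not_lt.1 fun hlt => ?_)⟩
  obtain ⟨r, hqr, hr⟩ :=
    exists_lt_le_chainRank (hp.subset (Set.Ici_subset_Ici.2 hq.prop.1)) hlt
  exact hq.not_prop_of_gt hqr ⟨hq.prop.1.trans hqr.le, hr⟩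

theorem IsOmegaPoset.finite_chainRank_lt {α : Type*} [PartialOrder α] (h : IsOmegaPoset α)
    (n : ℕ) : {p : α | chainRank p < n}.Finite := by
  induction n with
  | zero => simp
  | succ n ih =>
    refine ((Set.finite_Iic ({p : α | chainRank p < n}.ncard + 1)).biUnion
      fun k _ => h.2 k).subset fun p hp => ?_
    refine Set.mem_biUnion (Set.mem_Iic.2 ?_) (rfl : (Set.Ici p).ncard = _)
    have hsub : Set.Ici p ⊆ insert p {q : α | chainRank q < n} := fun q hq =>
      (eq_or_lt_of_le hq).imp Eq.symm fun hlt =>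
        (chainRank_lt_of_lt (h.1 p) hlt).trans_le (Nat.lt_succ_iff.1 hp)
    exact (Set.ncard_le_ncard hsub (ih.insert p)).trans (Set.ncard_insert_le _ _)

theorem IsOmegaPoset.finite_chainRank_le {α : Type*} [PartialOrder α] (h : IsOmegaPoset α)
    (n : ℕ) : {p : α | chainRank p ≤ n}.Finite :=
  (h.finite_chainRank_lt (n + 1)).subset fun _ => Nat.lt_succ_of_le

theorem IsOmegaPoset.isBand_levelSet {α : Type*} [PartialOrder α] (h : IsOmegaPoset α)
    (n : ℕ) : IsBand (levelSet α n) := by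
  refine ⟨(h.finite_chainRank_le n).subset fun _ hp => hp.1, fun p => ?_⟩
  rcases le_total (chainRank p) n with hp | hp
  · obtain ⟨q, hqp, hq⟩ := (h.finite_chainRank_le n).exists_le_minimal hp
    exact ⟨q, ⟨hq.prop, fun _ hr => hq.not_prop_of_lt hr⟩, Or.inr hqp⟩
  · obtain ⟨q, hpq, hq⟩ := exists_ge_chainRank_eq (h.1 p) hp
    exact ⟨q, ⟨hq.le, fun r hr => not_le.2 (hq ▸ chainRank_lt_of_lt (h.1 r) hr)⟩, Or.inl hpq⟩

theorem IsBand.exists_refines_levelSet {α : Type*} [PartialOrder α] {B : Set α}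
    (hB : IsBand B) : ∃ n : ℕ, Refines (levelSet α n) B := by
  obtain ⟨n, hn⟩ := (hB.1.image chainRank).bddAbove
  refine ⟨n, fun p hp => ?_⟩
  obtain ⟨b, hb, hpb | hbp⟩ := hB.2 p
  · exact ⟨b, hb, hpb⟩
  · rcases hbp.eq_or_lt with rfl | hlt
    · exact ⟨b, hb, le_rfl⟩
    · exact absurd (hn (Set.mem_image_of_mem _ hb)) (hp.2 b hlt)

/-- In an ω-poset, the levels are coinitial among the bands. -/
theorem levels_coinitial_in_bands {α : Type*} [PartialOrder α] (h : IsOmegaPoset α) :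
    (∀ n : ℕ, IsBand (levelSet α n)) ∧
    (∀ B : Set α, IsBand B → ∃ n : ℕ, Refines (levelSet α n) B) :=
  ⟨h.isBand_levelSet, fun _ hB => hB.exists_refines_levelSet⟩
end

section
/- If P is an ω-poset then no infinite cap of P is an antichain; i.e. every cap of P which is an antichain is finite. -/
/-- In an ω-poset, every cap which is an antichain is finite. -/
theorem antichain_cap_finite {α : Type*} [PartialOrder α] (h : IsOmegaPoset α)
    (C : Set α) (hC : IsCap C) (hA : IsAntichain (· ≤ ·) C) : C.Finite := by
  obtain ⟨B, ⟨hB, hcomp⟩, href⟩ := hC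
  refine (hB.biUnion fun b _ => h.1 b).subset fun c hc => ?_
  obtain ⟨b, hb, hcb | hbc⟩ := hcomp c
  · obtain ⟨d, hd, hbd⟩ := href b hb
    have hcd : c = d := hA.eq hc hd (hcb.trans hbd)
    exact Set.mem_biUnion hb (hbd.trans_eq hcd.symm)
  · exact Set.mem_biUnion hb hbc
end

section
/- Let X be a compact T1 topological space and P a family of subsets of X. Then P is an ω-band-basis of X if and only if P is a predetermined ω-cap-basis of X. -/
/-- In a predetermined poset with finite principal filters, any band has a member all of whose
upper bounds are comparable with a given element. -/
theorem Predetermined.exists_mem_band {α : Type*} [PartialOrder α] (hP : Predetermined α)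
    (hfin : ∀ p : α, (Set.Ici p).Finite) {B : Set α} (hB : IsBand B) (p : α) :
    ∃ b ∈ B, ∀ r, b ≤ r → r ≤ p ∨ p ≤ r := by
  by_contra! hcon
  let S : Set α := {q | q ≤ p ∧ ∀ r, q ≤ r → r ≤ p ∨ p ≤ r}
  have habove : ∀ q ∈ S, ∃ b ∈ B, b < q := by
    intro q hq
    obtain ⟨b, hb, hqb⟩ := hB.2 q
    obtain ⟨r, hbr, h₁, h₂⟩ := hcon b hb
    have hnot : ¬ q ≤ b := fun h => (hq.2 r (h.trans hbr)).elim h₁ h₂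
    exact ⟨b, hb, lt_of_le_not_ge (hqb.resolve_left hnot) hnot⟩
  have hSfin : S.Finite := by
    refine (hB.1.biUnion fun b _ => hfin b).subset fun q hq => ?_
    obtain ⟨b, hb, hbq⟩ := habove q hq
    exact Set.mem_biUnion hb hbq.le
  obtain ⟨q, hq⟩ := hSfin.exists_minimal ⟨p, le_rfl, fun r hr => Or.inr hr⟩
  obtain ⟨b, -, hbq⟩ := habove q hq.prop
  obtain ⟨q', hq'q, hq'⟩ := hP q (not_isMin_of_lt hbq)
  have hq'p : q' ≤ p := hq'q.le.trans hq.prop.1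
  refine hq.not_prop_of_lt hq'q ⟨hq'p, fun r hr => ?_⟩
  obtain rfl | hlt := hr.eq_or_lt
  · exact Or.inl hq'p
  · exact hq.prop.2 r (hq' r hlt)

/-- If `P` has finite principal filters and `p` does not witness predeterminedness, every `q < p`
lies below some element incomparable with `p`. -/
theorem exists_le_incomparable {α : Type*} [PartialOrder α] (hfin : ∀ p : α, (Set.Ici p).Finite)
    {p : α} (hp : ∀ q < p, ∃ r, q < r ∧ ¬ p ≤ r) {q : α} (hq : q < p) :
    ∃ r, q ≤ r ∧ ¬ r ≤ p ∧ ¬ p ≤ r := by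
  obtain ⟨m, hm⟩ := ((hfin q).subset (t := {r | q ≤ r ∧ r < p}) fun r hr => hr.1).exists_maximal
    ⟨q, le_rfl, hq⟩
  obtain ⟨r, hmr, hpr⟩ := hp m hm.prop.2
  have hqr : q ≤ r := hm.prop.1.trans hmr.le
  exact ⟨r, hqr, fun h => hm.not_prop_of_gt hmr ⟨hqr, lt_of_le_not_ge h hpr⟩, hpr⟩

/-- A cover of a compact space by members of a basis has a finite subcover. -/
theorem IsNeBasis.exists_finite_subcover {X : Type*} [TopologicalSpace X] [CompactSpace X]
    {P : Set (Set X)} (hP : IsNeBasis P) {C : Set ↥P}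
    (hC : (⋃ c ∈ C, (c : Set X)) = Set.univ) :
    ∃ B ⊆ C, B.Finite ∧ (⋃ b ∈ B, (b : Set X)) = Set.univ := by
  obtain ⟨B, hBC, hB, hcov⟩ := isCompact_univ.elim_finite_subcover_image
    (fun c _ => hP.1.isOpen c.2) hC.ge
  exact ⟨B, hBC, hB, Set.univ_subset_iff.1 hcov⟩

/-- A cover refining a family of sets makes that family a cover. -/
theorem Refines.iUnion_eq_univ {X : Type*} {P : Set (Set X)} {B C : Set ↥P} (h : Refines B C)
    (hB : (⋃ b ∈ B, (b : Set X)) = Set.univ) : (⋃ c ∈ C, (c : Set X)) = Set.univ := by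
  refine Set.univ_subset_iff.1 (hB.ge.trans (Set.iUnion₂_subset fun b hb => ?_))
  obtain ⟨c, hc, hbc⟩ := h b hb
  exact Set.Subset.trans hbc (Set.subset_biUnion_of_mem (u := fun c : ↥P => (c : Set X)) hc)

theorem IsBandBasis.isCapBasis {X : Type*} [TopologicalSpace X] [CompactSpace X]
    {P : Set (Set X)} (hP : IsBandBasis P) : IsCapBasis P := by
  refine ⟨hP.1, fun C => ⟨fun ⟨B, hB, hBC⟩ => hBC.iUnion_eq_univ ((hP.2 B).1 hB).2, fun hC => ?_⟩⟩
  obtain ⟨B, hBC, hB⟩ := hP.1.exists_finite_subcover hC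
  exact ⟨B, (hP.2 B).2 hB, fun b hb => ⟨b, hBC hb, le_rfl⟩⟩

/-- In a T1 space, every point of a non-minimal basis element `p` has a basic neighbourhood
strictly inside `p`. -/
theorem IsNeBasis.exists_mem_lt {X : Type*} [TopologicalSpace X] [T1Space X]
    {P : Set (Set X)} (hP : IsNeBasis P) {p : ↥P} (hp : ¬ IsMin p) {x : X} (hx : x ∈ (p : Set X)) :
    ∃ q : ↥P, x ∈ (q : Set X) ∧ q < p := by
  have hy : ∃ y ∈ (p : Set X), y ≠ x := by
    by_contra! h
    refine hp fun q hqp z hz => ?_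
    obtain ⟨w, hw⟩ := hP.2 q q.2
    rwa [h z hz, ← h w (hqp hw)]
  obtain ⟨y, hyp, hyx⟩ := hy
  obtain ⟨q, hqP, hxq, hqp⟩ := hP.1.exists_subset_of_mem_open (u := (p : Set X) ∩ {y}ᶜ)
    ⟨hx, hyx.symm⟩ ((hP.1.isOpen p.2).inter isOpen_compl_singleton)
  exact ⟨⟨q, hqP⟩, hxq, lt_of_le_not_ge (fun z hz => (hqp hz).1) fun h => (hqp (h hyp)).2 rfl⟩

theorem IsBandBasis.predetermined {X : Type*} [TopologicalSpace X] [CompactSpace X] [T1Space X]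
    {P : Set (Set X)} (hP : IsBandBasis P) (hfin : ∀ p : ↥P, (Set.Ici p).Finite) :
    Predetermined ↥P := by
  intro p hmin
  by_contra! hp
  have hcov : (⋃ r ∈ {r : ↥P | ¬ r ≤ p ∧ ¬ p ≤ r}, (r : Set X)) = Set.univ := by
    refine Set.eq_univ_of_forall fun x => ?_
    by_cases hx : x ∈ (p : Set X)
    · obtain ⟨q, hxq, hqp⟩ := hP.1.exists_mem_lt hmin hx
      obtain ⟨r, hqr, hr⟩ := exists_le_incomparable hfin hp hqp
      exact Set.mem_biUnion (t := fun r : ↥P => (r : Set X)) hr (hqr hxq)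
    · obtain ⟨y, hy⟩ := hP.1.2 p p.2
      obtain ⟨r, hrP, hxr, hry⟩ := hP.1.1.exists_subset_of_mem_open (u := {y}ᶜ)
        (fun h : x = y => hx (h ▸ hy)) isOpen_compl_singleton
      exact Set.mem_biUnion (x := (⟨r, hrP⟩ : ↥P)) (t := fun r : ↥P => (r : Set X))
        ⟨fun h => hx (h hxr), fun h => hry (h hy) rfl⟩ hxr
  obtain ⟨B, hB, hBcov⟩ := hP.1.exists_finite_subcover hcov
  obtain ⟨b, hb, hpb | hbp⟩ := ((hP.2 B).2 hBcov).2 p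
  · exact (hB hb).2 hpb
  · exact (hB hb).1 hbp

theorem IsCapBasis.isBandBasis {X : Type*} [TopologicalSpace X] {P : Set (Set X)}
    (hP : IsCapBasis P) (hfin : ∀ p : ↥P, (Set.Ici p).Finite) (hpre : Predetermined ↥P) :
    IsBandBasis P := by
  refine ⟨hP.1, fun B => ⟨fun hB => ⟨hB.1, (hP.2 B).1 ⟨B, hB, fun b hb => ⟨b, hb, le_rfl⟩⟩⟩,
    fun ⟨hBfin, hcov⟩ => ⟨hBfin, fun p => ?_⟩⟩⟩
  obtain ⟨A, hA, hAB⟩ := (hP.2 B).2 hcov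
  obtain ⟨a, ha, hap⟩ := hpre.exists_mem_band hfin hA p
  obtain ⟨b, hb, hab⟩ := hAB a ha
  exact ⟨b, hb, (hap b hab).symm⟩

/-- For a compact T1 space, ω-band-bases are exactly the predetermined
ω-cap-bases. -/
theorem omegaBandBasis_iff_predetermined_omegaCapBasis {X : Type*} [TopologicalSpace X]
    [CompactSpace X] [T1Space X] (P : Set (Set X)) :
    (IsBandBasis P ∧ IsOmegaPoset ↥P) ↔
      (IsCapBasis P ∧ IsOmegaPoset ↥P ∧ Predetermined ↥P) := by
  exact ⟨fun ⟨hP, hω⟩ => ⟨hP.isCapBasis, hω, hP.predetermined hω.1⟩,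
    fun ⟨hP, hω, hpre⟩ => ⟨hP.isBandBasis hω.1 hpre, hω⟩⟩
end

section
/- Every countable basis of a compact T1 topological space contains a subfamily which is an ω-band-basis of the space. -/
open Set TopologicalSpace

/-- A compact set covered by open members of a family has a finite subcover in which each member
contains a point of the set lying in no other member. -/
theorem IsCompact.exists_finite_irredundant_cover {X : Type*} [TopologicalSpace X]
    {A : Set X} (hA : IsCompact A) {B : Set (Set X)} (hB : ∀ b ∈ B, IsOpen b)
    (hAB : A ⊆ ⋃₀ B) :
    ∃ D ⊆ B, D.Finite ∧ A ⊆ ⋃₀ D ∧ ∀ p ∈ D, ∃ x ∈ A, x ∈ p ∧ ∀ q ∈ D, x ∈ q → q = p := by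
  obtain ⟨D₀, hD₀B, hD₀, hAD₀⟩ := hA.elim_finite_subcover_image (c := id) hB
    (by simpa [sUnion_eq_biUnion] using hAB)
  obtain ⟨D, ⟨hDD₀, hAD⟩, hmin⟩ := Set.Finite.exists_minimal
    (s := {D | D ⊆ D₀ ∧ A ⊆ ⋃₀ D}) (hD₀.finite_subsets.subset fun _ h => h.1)
    ⟨D₀, Subset.rfl, by simpa [sUnion_eq_biUnion] using hAD₀⟩
  refine ⟨D, hDD₀.trans hD₀B, hD₀.subset hDD₀, hAD, fun p hp => ?_⟩
  have hnot : ¬ A ⊆ ⋃₀ (D \ {p}) := fun h =>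
    (hmin ⟨sdiff_subset.trans hDD₀, h⟩ sdiff_subset hp).2 rfl
  obtain ⟨x, hxA, hx⟩ := not_subset.1 hnot
  have hpriv : ∀ q ∈ D, x ∈ q → q = p := fun q hq hxq => by
    by_contra hne
    exact hx ⟨q, ⟨hq, hne⟩, hxq⟩
  obtain ⟨q, hq, hxq⟩ := hAD hxA
  exact ⟨x, hxA, hpriv q hq hxq ▸ hxq, hpriv⟩

/-- Given a transitive open neighbourhood assignment `O` with finitely many values, a closed set
is covered by finitely many basic sets `p`, each of which is contained in `O x` for some `x ∈ p`
lying in no other member of the cover. -/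
theorem TopologicalSpace.IsTopologicalBasis.exists_finite_subordinate_cover
    {X : Type*} [TopologicalSpace X] [CompactSpace X]
    {B : Set (Set X)} (hB : IsTopologicalBasis B) {O : X → Set X} (hO : ∀ x, IsOpen (O x))
    (hself : ∀ x, x ∈ O x) (htrans : ∀ x, ∀ y ∈ O x, O y ⊆ O x) (hfin : (range O).Finite)
    {K : Set X} (hK : IsClosed K) :
    ∃ D ⊆ B, D.Finite ∧ K ⊆ ⋃₀ D ∧
      ∀ p ∈ D, ∃ x ∈ K, x ∈ p ∧ p ⊆ O x ∧ ∀ q ∈ D, x ∈ q → q = p := by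
  induction hn : (O '' K).ncard using Nat.strong_induction_on generalizing K with
  | _ n ih =>
  have hfinK : ∀ L : Set X, (O '' L).Finite := fun L => hfin.subset (image_subset_range O L)
  rcases K.eq_empty_or_nonempty with rfl | hKne
  · exact ⟨∅, empty_subset _, finite_empty, empty_subset _, fun _ h => h.elim⟩
  obtain ⟨_, ⟨x, hxK, rfl⟩, hmax⟩ := (hfinK K).exists_maximal (hKne.image O)
  have hmax' : ∀ y ∈ K, O x ⊆ O y → O y = O x := fun y hy h =>
    (hmax ⟨y, hy, rfl⟩ h).antisymm h
  have hA : {y ∈ K | O y = O x} = K ∩ (⋃ z ∈ {z ∈ K | O z ≠ O x}, O z)ᶜ := by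
    ext y
    simp only [mem_ofPred_eq, mem_inter_iff, mem_compl_iff, mem_iUnion, not_exists]
    refine and_congr_right fun hy => ⟨fun h z hz hyz => hz.2 (hmax' z hz.1 ?_), fun h => ?_⟩
    · exact h ▸ htrans z y hyz
    · by_contra hne
      exact h y ⟨hy, hne⟩ (hself y)
  have hAc : IsClosed {y ∈ K | O y = O x} := by
    rw [hA]
    exact hK.inter (isOpen_biUnion fun z _ => hO z).isClosed_compl
  obtain ⟨D, hDB, hDfin, hAD, hDw⟩ := hAc.isCompact.exists_finite_irredundant_cover
    (B := {b ∈ B | b ⊆ O x}) (fun b hb => hB.isOpen hb.1) (fun y hy => by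
      obtain ⟨b, hb, hyb, hbO⟩ := hB.exists_subset_of_mem_open (hself y) (hO y)
      exact ⟨b, ⟨hb, hy.2 ▸ hbO⟩, hyb⟩)
  have hDo : IsOpen (⋃₀ D) := isOpen_sUnion fun d hd => hB.isOpen (hDB hd).1
  have hnot : ∀ z ∈ K \ ⋃₀ D, O z ≠ O x := fun z hz h => hz.2 (hAD ⟨hz.1, h⟩)
  have hlt : (O '' (K \ ⋃₀ D)).ncard < n := by
    rw [← hn]
    refine ncard_lt_ncard ⟨image_mono sdiff_subset, fun h => ?_⟩ (hfinK K)
    obtain ⟨z, hz, hzx⟩ := h ⟨x, hxK, rfl⟩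
    exact hnot z hz hzx
  obtain ⟨E, hEB, hEfin, hKE, hEw⟩ := ih _ hlt (hK.sdiff hDo) rfl
  refine ⟨D ∪ E, union_subset (fun d hd => (hDB hd).1) hEB, hDfin.union hEfin, ?_, ?_⟩
  · intro y hy
    rw [sUnion_union]
    by_cases hyD : y ∈ ⋃₀ D
    · exact Or.inl hyD
    · exact Or.inr (hKE ⟨hy, hyD⟩)
  · rintro p (hp | hp)
    · obtain ⟨y, hyA, hyp, hpriv⟩ := hDw p hp
      refine ⟨y, hyA.1, hyp, hyA.2 ▸ (hDB hp).2, ?_⟩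
      rintro q (hq | hq) hyq
      · exact hpriv q hq hyq
      · obtain ⟨z, hzK, -, hqz, -⟩ := hEw q hq
        exact absurd (hmax' z hzK.1 (hyA.2 ▸ htrans z y (hqz hyq))) (hnot z hzK)
    · obtain ⟨y, hyK, hyp, hpO, hpriv⟩ := hEw p hp
      refine ⟨y, hyK.1, hyp, hpO, ?_⟩
      rintro q (hq | hq) hyq
      · exact absurd ⟨q, hq, hyq⟩ hyK.2
      · exact hpriv q hq hyq

/-- Given finitely many open sets `F` and an open cover `V`, there is a finite cover by basic sets
refining `V` in which each member `p` has a point `x` lying in no other member, such that `p` is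
contained in every `f ∈ F` with `x ∈ f`. -/
theorem TopologicalSpace.IsTopologicalBasis.exists_finite_cover_refining
    {X : Type*} [TopologicalSpace X] [CompactSpace X]
    {B : Set (Set X)} (hB : IsTopologicalBasis B) {F V : Set (Set X)} (hF : F.Finite)
    (hFo : ∀ f ∈ F, IsOpen f) (hVo : ∀ v ∈ V, IsOpen v) (hV : ⋃₀ V = univ) :
    ∃ C ⊆ B, C.Finite ∧ ⋃₀ C = univ ∧ (∀ p ∈ C, ∃ v ∈ V, p ⊆ v) ∧
      ∀ p ∈ C, ∃ x ∈ p, (∀ f ∈ F, x ∈ f → p ⊆ f) ∧ ∀ q ∈ C, x ∈ q → q = p := by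
  have hB' : IsTopologicalBasis {b ∈ B | ∃ v ∈ V, b ⊆ v} := by
    refine isTopologicalBasis_of_isOpen_of_nhds (fun b hb => hB.isOpen hb.1) fun x U hx hU => ?_
    obtain ⟨v, hv, hxv⟩ : x ∈ ⋃₀ V := hV ▸ mem_univ x
    obtain ⟨b, hb, hxb, hbU⟩ :=
      hB.exists_subset_of_mem_open (show x ∈ U ∩ v from ⟨hx, hxv⟩) (hU.inter (hVo v hv))
    exact ⟨b, ⟨hb, v, hv, hbU.trans inter_subset_right⟩, hxb, hbU.trans inter_subset_left⟩
  obtain ⟨C, hCB, hC, hCcov, hCw⟩ := hB'.exists_finite_subordinate_cover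
    (O := fun x => ⋂₀ {f ∈ F | x ∈ f})
    (fun x => (hF.subset (sep_subset _ _)).isOpen_sInter fun f hf => hFo f hf.1)
    (fun x f hf => hf.2) (fun x y hy => sInter_subset_sInter fun f hf => ⟨hf.1, hy f hf⟩)
    ((hF.finite_subsets.image sInter).subset (by
      rintro _ ⟨x, rfl⟩
      exact ⟨_, sep_subset _ _, rfl⟩))
    isClosed_univ
  refine ⟨C, fun p hp => (hCB hp).1, hC, univ_subset_iff.1 hCcov, fun p hp => (hCB hp).2,
    fun p hp => ?_⟩
  obtain ⟨x, -, hxp, hpO, hpriv⟩ := hCw p hp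
  exact ⟨x, hxp, fun f hf hxf => hpO.trans (sInter_subset_of_mem ⟨hf, hxf⟩), hpriv⟩

/-- A sequence of finite covers in which each member `p` of the `n`-th cover has a point lying in
no other member of that cover, such that `p` is contained in every member of an earlier
cover containing this point. -/
structure IsSubordinateCoverSeq {X : Type*} (C : ℕ → Set (Set X)) : Prop where
  finite : ∀ n, (C n).Finite
  sUnion_eq : ∀ n, ⋃₀ C n = univ
  exists_point : ∀ n, ∀ p ∈ C n, ∃ x ∈ p,
    (∀ m < n, ∀ f ∈ C m, x ∈ f → p ⊆ f) ∧ ∀ q ∈ C n, x ∈ q → q = p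

/-- From a countable basis of a compact T1 space one can extract a subordinate sequence of covers
whose members containing any given point are eventually arbitrarily small. -/
theorem TopologicalSpace.IsTopologicalBasis.exists_isSubordinateCoverSeq
    {X : Type*} [TopologicalSpace X] [CompactSpace X] [T1Space X]
    {B : Set (Set X)} (hB : IsTopologicalBasis B) (hc : B.Countable) :
    ∃ C : ℕ → Set (Set X), IsSubordinateCoverSeq C ∧ (∀ n, C n ⊆ B) ∧
      ∀ U, IsOpen U → ∀ x ∈ U, ∃ n, ∀ p ∈ C n, x ∈ p → p ⊆ U := by
  obtain ⟨V, hV⟩ : ∃ V : ℕ → Set (Set X),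
      {V : Set (Set X) | V.Finite ∧ V ⊆ insert univ B ∧ ⋃₀ V = univ} = range V := by
    refine Countable.exists_eq_range ?_ ⟨{univ}, finite_singleton _, by simp, by simp⟩
    refine (countable_ofPred_finite_subset (hc.insert univ)).mono ?_
    exact fun V h => ⟨h.1, h.2.1⟩
  have hVmem : ∀ n, V n ⊆ insert univ B ∧ ⋃₀ V n = univ := fun n =>
    (hV.symm ▸ mem_range_self n : V n ∈ {V : Set (Set X) | _}).2
  have hVo : ∀ n, ∀ v ∈ V n, IsOpen v := fun n v hv => by
    rcases (hVmem n).1 hv with rfl | h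
    · exact isOpen_univ
    · exact hB.isOpen h
  have hstep : ∀ (n : ℕ) (F : {F : Set (Set X) // F.Finite ∧ F ⊆ B}), _ := fun n F =>
    hB.exists_finite_cover_refining F.2.1 (fun f hf => hB.isOpen (F.2.2 hf)) (hVo n) (hVmem n).2
  choose step hsB hsfin hscov hsref hsw using hstep
  let F : ℕ → {F : Set (Set X) // F.Finite ∧ F ⊆ B} := fun n =>
    Nat.rec ⟨∅, finite_empty, empty_subset _⟩
      (fun n F => ⟨F.1 ∪ step n F, F.2.1.union (hsfin n F), union_subset F.2.2 (hsB n F)⟩) n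
  have hFmono : Monotone fun n => (F n).1 := monotone_nat_of_le_succ fun n => subset_union_left
  have hFmem : ∀ {m n}, m < n → step m (F m) ⊆ (F n).1 := fun {m n} h =>
    (subset_union_right : _ ⊆ (F m).1 ∪ step m (F m)).trans (hFmono (Nat.succ_le_of_lt h))
  refine ⟨fun n => step n (F n), ⟨fun n => hsfin _ _, fun n => hscov _ _, fun n p hp => ?_⟩,
    fun n => hsB _ _, fun U hU x hx => ?_⟩
  · obtain ⟨x, hxp, hxf, hpriv⟩ := hsw n (F n) p hp
    exact ⟨x, hxp, fun m hm f hf => hxf f (hFmem hm hf), hpriv⟩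
  · obtain ⟨b, hb, hxb, hbU⟩ := hB.exists_subset_of_mem_open hx hU
    obtain ⟨W, hWB, hW, hWcov⟩ := isCompact_univ.elim_finite_subcover_image
      (b := insert b {c ∈ B | x ∉ c}) (c := id)
      (by
        rintro c (rfl | hc)
        · exact hB.isOpen hb
        · exact hB.isOpen hc.1)
      (fun y _ => by
        change y ∈ ⋃ c ∈ insert b {c ∈ B | x ∉ c}, c
        rw [← sUnion_eq_biUnion]
        by_cases hyx : y = x
        · exact ⟨b, mem_insert _ _, hyx ▸ hxb⟩
        · obtain ⟨c, hc, hyc, hcx⟩ := hB.exists_subset_of_mem_open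
            (show y ∈ ({x} : Set X)ᶜ from hyx) isOpen_compl_singleton
          exact ⟨c, Or.inr ⟨hc, fun h => hcx h rfl⟩, hyc⟩)
    obtain ⟨n, hn⟩ : W ∈ range V := hV ▸ ⟨hW, fun w hw => Or.inr (by
      rcases hWB hw with rfl | h
      · exact hb
      · exact h.1), univ_subset_iff.1 (sUnion_eq_biUnion ▸ hWcov)⟩
    refine ⟨n, fun p hp hxp => ?_⟩
    obtain ⟨v, hv, hpv⟩ := hsref n (F n) p hp
    rcases hWB (hn ▸ hv) with rfl | h
    · exact hpv.trans hbU
    · exact absurd (hpv hxp) h.2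

namespace IsSubordinateCoverSeq

variable {X : Type*} {C : ℕ → Set (Set X)}

theorem nonempty_of_mem (hC : IsSubordinateCoverSeq C) {n : ℕ} {p : Set X} (hp : p ∈ C n) :
    p.Nonempty :=
  let ⟨x, hx, _⟩ := hC.exists_point n p hp
  ⟨x, hx⟩

theorem exists_superset (hC : IsSubordinateCoverSeq C) {m n : ℕ} (hmn : m ≤ n) {p : Set X}
    (hp : p ∈ C n) : ∃ q ∈ C m, p ⊆ q := by
  rcases hmn.eq_or_lt with rfl | hlt
  · exact ⟨p, hp, Subset.rfl⟩
  · obtain ⟨x, -, hx, -⟩ := hC.exists_point n p hp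
    obtain ⟨q, hq, hxq⟩ : x ∈ ⋃₀ C m := hC.sUnion_eq m ▸ mem_univ x
    exact ⟨q, hq, hx m hlt q hq hxq⟩

/-- Every member contains a point such that all members containing it are comparable to it. -/
theorem exists_point_comparable (hC : IsSubordinateCoverSeq C) {n : ℕ} {p : Set X}
    (hp : p ∈ C n) : ∃ x, ∀ m, ∀ f ∈ C m, x ∈ f → p ⊆ f ∨ f ⊆ p := by
  obtain ⟨x, -, hx, hpriv⟩ := hC.exists_point n p hp
  refine ⟨x, fun m f hf hxf => ?_⟩
  rcases lt_or_ge m n with h | h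
  · exact Or.inl (hx m h f hf hxf)
  · obtain ⟨q, hq, hfq⟩ := hC.exists_superset h hf
    exact Or.inr (hpriv q hq (hfq hxf) ▸ hfq)

theorem finite_setOf_mem_lt (hC : IsSubordinateCoverSeq C) (N : ℕ) :
    {p : ↥(⋃ n, C n) | ∃ n < N, p.1 ∈ C n}.Finite := by
  have h : (⋃ n ∈ Iio N, C n).Finite := (finite_Iio N).biUnion fun n _ => hC.finite n
  refine (h.preimage Subtype.val_injective.injOn).subset ?_
  rintro p ⟨n, hn, hp⟩
  exact mem_biUnion hn hp

variable [TopologicalSpace X]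

theorem eventually_subset (hC : IsSubordinateCoverSeq C)
    (hsmall : ∀ U, IsOpen U → ∀ x ∈ U, ∃ n, ∀ p ∈ C n, x ∈ p → p ⊆ U)
    {U : Set X} (hU : IsOpen U) {x : X} (hx : x ∈ U) :
    ∃ N, ∀ n ≥ N, ∀ p ∈ C n, x ∈ p → p ⊆ U := by
  obtain ⟨N, hN⟩ := hsmall U hU x hx
  refine ⟨N, fun n hn p hp hxp => ?_⟩
  obtain ⟨q, hq, hpq⟩ := hC.exists_superset hn hp
  exact hpq.trans (hN q hq (hpq hxp))

theorem isTopologicalBasis_iUnion (hC : IsSubordinateCoverSeq C)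
    (hsmall : ∀ U, IsOpen U → ∀ x ∈ U, ∃ n, ∀ p ∈ C n, x ∈ p → p ⊆ U)
    (hopen : ∀ n, ∀ p ∈ C n, IsOpen p) : IsTopologicalBasis (⋃ n, C n) := by
  refine isTopologicalBasis_of_isOpen_of_nhds (fun p hp => ?_) fun x U hx hU => ?_
  · obtain ⟨n, hn⟩ := mem_iUnion.1 hp
    exact hopen n p hn
  · obtain ⟨n, hn⟩ := hsmall U hU x hx
    obtain ⟨p, hp, hxp⟩ : x ∈ ⋃₀ C n := hC.sUnion_eq n ▸ mem_univ x
    exact ⟨p, mem_iUnion.2 ⟨n, hp⟩, hxp, hn p hp hxp⟩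

variable [T1Space X]

theorem isBandBasis_iUnion (hC : IsSubordinateCoverSeq C)
    (hsmall : ∀ U, IsOpen U → ∀ x ∈ U, ∃ n, ∀ p ∈ C n, x ∈ p → p ⊆ U)
    (hopen : ∀ n, ∀ p ∈ C n, IsOpen p) : IsBandBasis (⋃ n, C n) := by
  have hbasis := hC.isTopologicalBasis_iUnion hsmall hopen
  have hne : ∀ p ∈ ⋃ n, C n, p.Nonempty := fun p hp =>
    let ⟨_, hn⟩ := mem_iUnion.1 hp
    hC.nonempty_of_mem hn
  refine ⟨⟨hbasis, hne⟩, fun E => and_congr_right fun hE => ⟨fun hband => ?_, fun hcov p => ?_⟩⟩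
  · by_contra hcov
    obtain ⟨x, hx⟩ := (ne_univ_iff_exists_notMem _).1 hcov
    simp only [mem_iUnion, not_exists] at hx
    choose y hy using fun e : ↥(⋃ n, C n) => hne e.1 e.2
    obtain ⟨p, hp, hxp, hpy⟩ := hbasis.exists_subset_of_mem_open
      (show x ∈ (y '' E)ᶜ from fun ⟨e, he, hex⟩ => hx e he (hex ▸ hy e))
      (hE.image y).isClosed.isOpen_compl
    obtain ⟨e, he, hpe | hep⟩ := hband ⟨p, hp⟩
    · exact hx e he (hpe hxp)
    · exact hpy (hep (hy e)) ⟨e, he, rfl⟩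
  · obtain ⟨n, hn⟩ := mem_iUnion.1 p.2
    obtain ⟨x, hx⟩ := hC.exists_point_comparable hn
    obtain ⟨f, hf, hxf⟩ := mem_iUnion₂.1 (hcov ▸ mem_univ x)
    obtain ⟨m, hm⟩ := mem_iUnion.1 f.2
    exact ⟨f, hf, hx m f hm hxf⟩

theorem isOmegaPoset_iUnion (hC : IsSubordinateCoverSeq C)
    (hsmall : ∀ U, IsOpen U → ∀ x ∈ U, ∃ n, ∀ p ∈ C n, x ∈ p → p ⊆ U)
    (hopen : ∀ n, ∀ p ∈ C n, IsOpen p) : IsOmegaPoset ↥(⋃ n, C n) := by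
  have hIci : ∀ p : ↥(⋃ n, C n), (Ici p).Finite := fun p => by
    obtain ⟨n, hn⟩ := mem_iUnion.1 p.2
    obtain ⟨x, hx⟩ := hC.nonempty_of_mem hn
    obtain ⟨N, hN⟩ := hC.eventually_subset hsmall (hopen n p hn) hx
    refine ((hC.finite_setOf_mem_lt N).insert p).subset fun q hq => ?_
    obtain ⟨m, hm⟩ := mem_iUnion.1 q.2
    rcases lt_or_ge m N with h | h
    · exact Or.inr ⟨m, h, hm⟩
    · exact Or.inl (le_antisymm (hN m h q hm (hq hx)) hq)
  have hsub : ∀ p : ↥(⋃ n, C n), ∃ N, ∀ n ≥ N, p.1 ∈ C n → p.1.Subsingleton := fun p => by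
    by_contra! h
    obtain ⟨-, -, -, x, hx, y, hy, hxy⟩ := h 0
    obtain ⟨N, hN⟩ := hC.eventually_subset hsmall isOpen_compl_singleton
      (show x ∈ ({y} : Set X)ᶜ from hxy)
    obtain ⟨n, hn, hp, -⟩ := h N
    exact hN n hn p hp hx hy rfl
  choose M hM using hsub
  have hle : ∀ k, {p : ↥(⋃ n, C n) | (Ici p).ncard ≤ k}.Finite := fun k => by
    induction k with
    | zero =>
      refine finite_empty.subset fun p hp => ?_
      exact ((ncard_pos (hIci p)).2 nonempty_Ici).ne' (Nat.le_zero.1 hp)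
    | succ k ih =>
      obtain ⟨N, hN⟩ := (ih.image M).bddAbove
      refine (hC.finite_setOf_mem_lt (N + 1)).subset fun p hp => ?_
      obtain ⟨m, hm⟩ := mem_iUnion.1 p.2
      rcases lt_or_ge m (N + 1) with h | h
      · exact ⟨m, h, hm⟩
      obtain ⟨c, hc, hpc⟩ := hC.exists_superset ((Nat.le_succ N).trans h) hm
      let c' : ↥(⋃ n, C n) := ⟨c, mem_iUnion.2 ⟨N, hc⟩⟩
      rcases (show p ≤ c' from hpc).eq_or_lt with heq | hlt
      · exact ⟨N, N.lt_succ_self, heq ▸ hc⟩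
      have hcard : (Ici c').ncard < (Ici p).ncard :=
        ncard_lt_ncard (Ici_ssubset_Ici.2 hlt) (hIci p)
      have hck : (Ici c').ncard ≤ k := Nat.lt_succ_iff.1 (hcard.trans_le hp)
      have hcs : c.Subsingleton := hM c' N (hN ⟨c', hck, rfl⟩) hc
      obtain ⟨x, hx⟩ := hC.nonempty_of_mem hm
      exact absurd (fun y hy => hcs (hpc hx) hy ▸ hx : c' ≤ p) hlt.not_ge
  exact ⟨hIci, fun k => (hle k).subset fun p hp => le_of_eq hp⟩

end IsSubordinateCoverSeq

/-- Any countable basis of a compact T1 space contains an ω-band-basis. -/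
theorem countable_basis_contains_omegaBandBasis {X : Type*} [TopologicalSpace X]
    [CompactSpace X] [T1Space X]
    (B : Set (Set X)) (hB : TopologicalSpace.IsTopologicalBasis B) (hc : B.Countable) :
    ∃ P : Set (Set X), P ⊆ B ∧ IsBandBasis P ∧ IsOmegaPoset ↥P := by
  obtain ⟨C, hC, hCB, hsmall⟩ := hB.exists_isSubordinateCoverSeq hc
  have hopen : ∀ n, ∀ p ∈ C n, IsOpen p := fun n p hp => hB.isOpen (hCB n hp)
  exact ⟨⋃ n, C n, iUnion_subset hCB, hC.isBandBasis_iUnion hsmall hopen,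
    hC.isOmegaPoset_iUnion hsmall hopen⟩
end

section
/- Every second countable compact T1 topological space has a graded ω-band-basis. -/
/-- A poset with a level function: levels strictly decrease upwards, every element of positive
level lies below an element of the preceding level, and no covering relation skips a level. -/
structure IsGrading {α : Type*} [PartialOrder α] (lev : α → ℕ) : Prop where
  anti : ∀ p q, p < q → lev q < lev p
  up : ∀ p, lev p ≠ 0 → ∃ q, p < q ∧ lev q + 1 = lev p
  between : ∀ p q, p < q → lev q + 1 < lev p → ∃ r, p < r ∧ r < q

namespace IsGrading

variable {α : Type*} [PartialOrder α] {lev : α → ℕ}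

lemma chainRank_eq (h : IsGrading lev) (p : α) : chainRank p = lev p := by
  refine IsGreatest.csSup_eq ⟨?_, ?_⟩
  · have h_up : ∀ p, ∃ q, lev p ≠ 0 → p < q ∧ lev q + 1 = lev p := fun p ↦ by
      by_cases hp : lev p = 0
      · exact ⟨p, fun h ↦ absurd hp h⟩
      · obtain ⟨q, hq⟩ := h.up p hp
        exact ⟨q, fun _ ↦ hq⟩
    choose f hf using h_up
    have key : ∀ i ≤ lev p, lev (f^[i] p) + i = lev p := by
      intro i
      induction i with
      | zero => simp
      | succ i ih =>
        intro hi
        have h1 := ih (by omega)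
        have h2 := (hf (f^[i] p) (by omega)).2
        rw [Function.iterate_succ_apply']
        omega
    refine ⟨fun i ↦ f^[i] p, rfl, fun i hi ↦ ?_⟩
    have h1 := key i hi.le
    simp only [Function.iterate_succ_apply']
    exact (hf _ (by omega)).1
  · rintro n ⟨c, h0, hc⟩
    have key : ∀ i ≤ n, lev (c i) + i ≤ lev p := by
      intro i
      induction i with
      | zero => simp [h0]
      | succ i ih =>
        intro hi
        have h1 := ih (by omega)
        have h2 := h.anti _ _ (hc i (by omega))
        omega
    have := key n le_rfl
    omega

lemma gradedPoset (h : IsGrading lev) : GradedPoset α := by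
  intro p q hpq
  rw [h.chainRank_eq, h.chainRank_eq]
  by_contra hne
  have h1 := h.anti p q hpq.lt
  obtain ⟨r, hr1, hr2⟩ := h.between p q hpq.lt (by omega)
  exact hpq.2 hr1 hr2

lemma exists_le_lev_eq (h : IsGrading lev) (p : α) {n : ℕ} (hn : n ≤ lev p) :
    ∃ q, p ≤ q ∧ lev q = n := by
  induction hn using Nat.decreasingInduction with
  | self => exact ⟨p, le_rfl, rfl⟩
  | of_succ k hk ih =>
    obtain ⟨q, hpq, hq⟩ := ih
    obtain ⟨r, hqr, hr⟩ := h.up q (by omega)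
    exact ⟨r, hpq.trans hqr.le, by omega⟩

lemma isOmegaPoset (h : IsGrading lev) (hfin : ∀ n, {p | lev p ≤ n}.Finite) :
    IsOmegaPoset α := by
  have hIci : ∀ p : α, (Set.Ici p).Finite := fun p ↦ (hfin (lev p)).subset fun q hq ↦ by
    rcases (Set.mem_Ici.1 hq).eq_or_lt with rfl | hlt
    · exact le_rfl (a := lev p)
    · exact (h.anti _ _ hlt).le
  refine ⟨hIci, fun n ↦ (hfin n).subset ?_⟩
  rintro p rfl
  have hsub : Set.Iic (lev p) ⊆ lev '' Set.Ici p := fun n hn ↦ h.exists_le_lev_eq p hn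
  have h1 := Set.ncard_le_ncard hsub ((hIci p).image _)
  have h2 := Set.ncard_image_le (f := lev) (hIci p)
  have h3 : (Set.Iic (lev p)).ncard = lev p + 1 := by
    rw [Set.ncard_eq_toFinset_card']
    simp
  change lev p ≤ _
  omega

end IsGrading

/-- The properties of a finite open cover `C` built on top of a finite family `F` of open sets. -/
structure IsCoverOver {X : Type*} [TopologicalSpace X] (F C : Set (Set X)) : Prop where
  finite : C.Finite
  isOpen : ∀ c ∈ C, IsOpen c
  exists_point : ∀ c ∈ C, ∃ z ∈ c, (∀ d ∈ C, z ∈ d → d = c) ∧ ∀ q ∈ F, z ∈ q → c ⊆ q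
  exists_mem : ∀ x, ∃ c ∈ C, x ∈ c ∧ ∀ q ∈ F, x ∈ q → c ⊆ q
  subsingleton : ∀ q ∈ F, ∀ c ∈ C, q ⊆ c → q.Subsingleton

lemma exists_isCoverOver {X : Type*} [TopologicalSpace X] [T1Space X] {F : Set (Set X)}
    (hF : F.Finite) (hFo : ∀ q ∈ F, IsOpen q) : ∃ C, IsCoverOver F C := by
  obtain ⟨Z₁, hZ₁, hrep⟩ :
      ∃ Z : Set X, Z.Finite ∧ ∀ x, ∃ z ∈ Z, ∀ q ∈ F, z ∈ q ↔ x ∈ q := by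
    let g : X → Set (Set X) := fun x ↦ {q | q ∈ F ∧ x ∈ q}
    have hg : (g '' Set.univ).Finite := hF.finite_subsets.subset (by
      rintro _ ⟨x, -, rfl⟩ q hq
      exact hq.1)
    obtain ⟨Z, -, hZg⟩ := Set.exists_subset_bijOn Set.univ g
    refine ⟨Z, (Set.finite_image_iff hZg.injOn).1 (hZg.image_eq.symm ▸ hg), fun x ↦ ?_⟩
    obtain ⟨z, hz, hzx⟩ : g x ∈ g '' Z := hZg.image_eq.symm ▸ ⟨x, trivial, rfl⟩
    refine ⟨z, hz, fun q hq ↦ ?_⟩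
    have := Set.ext_iff.1 hzx q
    simpa [g, hq] using this
  obtain ⟨Z₂, hZ₂, hsep⟩ :
      ∃ Z : Set X, Z.Finite ∧ ∀ q ∈ F, (q ∩ Z).Subsingleton → q.Subsingleton := by
    have : ∀ q : Set X, ∃ A : Set X, A.Finite ∧ ((q ∩ A).Subsingleton → q.Subsingleton) := by
      intro q
      by_cases hq : q.Subsingleton
      · exact ⟨∅, Set.finite_empty, fun _ ↦ hq⟩
      · obtain ⟨x, hx, y, hy, hxy⟩ := Set.not_subsingleton_iff.1 hq
        exact ⟨{x, y}, by simp, fun h ↦ absurd (h ⟨hx, by simp⟩ ⟨hy, by simp⟩) hxy⟩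
    choose A hA hAq using this
    refine ⟨⋃ q ∈ F, A q, hF.biUnion fun q _ ↦ hA q, fun q hq h ↦ hAq q (h.anti ?_)⟩
    exact Set.inter_subset_inter_right _ (Set.subset_biUnion_of_mem hq)
  let Z := Z₁ ∪ Z₂
  have hZ : Z.Finite := hZ₁.union hZ₂
  let V : X → Set X := fun z ↦ {x | (∀ q ∈ F, z ∈ q → x ∈ q) ∧ (x ∈ Z → x = z)}
  have hVself : ∀ z, z ∈ V z := fun z ↦ ⟨fun _ _ h ↦ h, fun _ ↦ rfl⟩
  have hV : ∀ z, ∀ q ∈ F, z ∈ q → V z ⊆ q := fun z q hq hz x hx ↦ hx.1 q hq hz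
  refine ⟨V '' Z, hZ.image V, ?_, ?_, ?_, ?_⟩
  · rintro _ ⟨z, -, rfl⟩
    have : V z = (⋂ q ∈ {q | q ∈ F ∧ z ∈ q}, q) ∩ (Z \ {z})ᶜ := by
      ext x
      simp [V]
    rw [this]
    exact ((hF.subset fun q hq ↦ hq.1).isOpen_biInter fun q hq ↦ hFo q hq.1).inter
      (hZ.subset Set.sdiff_subset).isClosed.isOpen_compl
  · rintro _ ⟨z, hz, rfl⟩
    refine ⟨z, hVself z, ?_, hV z⟩
    rintro _ ⟨w, -, rfl⟩ hzw
    rw [hzw.2 hz]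
  · intro x
    by_cases hx : x ∈ Z
    · exact ⟨V x, ⟨x, hx, rfl⟩, hVself x, hV x⟩
    · obtain ⟨z, hz, hzx⟩ := hrep x
      exact ⟨V z, ⟨z, Or.inl hz, rfl⟩, ⟨fun q hq ↦ (hzx q hq).1, fun h ↦ absurd h hx⟩,
        fun q hq hxq ↦ hV z q hq ((hzx q hq).2 hxq)⟩
  · rintro q hq _ ⟨z, -, rfl⟩ hqz
    refine hsep q hq ?_
    rintro x ⟨hxq, hx⟩ y ⟨hyq, hy⟩
    rw [(hqz hxq).2 (Or.inr hx), (hqz hyq).2 (Or.inr hy)]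

/-- Given a sequence `b` of open sets, there is a sequence of covers, each of which is built over
all the previous covers and an initial segment of `b`. -/
lemma exists_seq_isCoverOver {X : Type*} [TopologicalSpace X] [T1Space X] (b : ℕ → Set X)
    (hb : ∀ i, IsOpen (b i)) :
    ∃ F C : ℕ → Set (Set X), (∀ m, IsCoverOver (F m) (C m)) ∧
      (∀ k m, k < m → C k ⊆ F m) ∧ ∀ i m, i ≤ m → b i ∈ F m := by
  have : ∀ F : Set (Set X), ∃ C, F.Finite → (∀ q ∈ F, IsOpen q) → IsCoverOver F C := by
    intro F
    by_cases h : F.Finite ∧ ∀ q ∈ F, IsOpen q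
    · obtain ⟨C, hC⟩ := exists_isCoverOver h.1 h.2
      exact ⟨C, fun _ _ ↦ hC⟩
    · exact ⟨∅, fun h1 h2 ↦ absurd ⟨h1, h2⟩ h⟩
  choose N hN using this
  let F : ℕ → Set (Set X) := fun n ↦
    Nat.rec {b 0} (fun m D ↦ insert (b (m + 1)) (D ∪ N D)) n
  have hsucc : ∀ m, F (m + 1) = insert (b (m + 1)) (F m ∪ N (F m)) := fun m ↦ rfl
  have hF : ∀ m, (F m).Finite ∧ ∀ q ∈ F m, IsOpen q := by
    intro m
    induction m with
    | zero =>
      refine ⟨Set.finite_singleton (b 0), ?_⟩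
      rintro q rfl
      exact hb 0
    | succ m ih =>
      have hC := hN (F m) ih.1 ih.2
      rw [hsucc]
      refine ⟨(ih.1.union hC.finite).insert _, ?_⟩
      rintro q (rfl | hq | hq)
      exacts [hb _, ih.2 q hq, hC.isOpen q hq]
  have hmono : Monotone F := monotone_nat_of_le_succ fun m ↦ by
    rw [hsucc]
    exact Set.subset_union_left.trans (Set.subset_insert _ _)
  refine ⟨F, fun m ↦ N (F m), fun m ↦ hN _ (hF m).1 (hF m).2, fun k m hkm ↦ ?_,
    fun i m him ↦ hmono him ?_⟩
  · refine Set.Subset.trans ?_ (hmono (Nat.succ_le_of_lt hkm))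
    rw [Nat.succ_eq_add_one, hsucc]
    exact Set.subset_union_right.trans (Set.subset_insert _ _)
  · cases i with
    | zero => exact Set.mem_singleton (b 0)
    | succ i =>
      rw [hsucc]
      exact Set.mem_insert _ _

/-- A sequence of minimal finite open covers, consecutively refining and shrinking, whose elements
form a basis. -/
structure IsLevelSequence {X : Type*} [TopologicalSpace X] (C : ℕ → Set (Set X)) : Prop where
  finite : ∀ m, (C m).Finite
  isOpen : ∀ m, ∀ c ∈ C m, IsOpen c
  exists_point : ∀ m, ∀ c ∈ C m, ∃ z ∈ c, (∀ d ∈ C m, z ∈ d → d = c) ∧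
    ∀ k < m, ∀ q ∈ C k, z ∈ q → c ⊆ q
  exists_mem : ∀ m x, ∃ c ∈ C m, x ∈ c ∧ ∀ k < m, ∀ q ∈ C k, x ∈ q → c ⊆ q
  subsingleton : ∀ k m, k < m → ∀ q ∈ C k, ∀ c ∈ C m, q ⊆ c → q.Subsingleton
  small : ∀ x O, IsOpen O → x ∈ O → ∃ M, ∀ m ≥ M, ∀ c ∈ C m, x ∈ c → c ⊆ O

lemma exists_isLevelSequence (X : Type*) [TopologicalSpace X] [SecondCountableTopology X]
    [CompactSpace X] [T1Space X] : ∃ C : ℕ → Set (Set X), IsLevelSequence C := by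
  obtain ⟨b, hbo, hb⟩ : ∃ b : ℕ → Set X, (∀ i, IsOpen (b i)) ∧
      ∀ x O, IsOpen O → x ∈ O → ∃ i, x ∈ b i ∧ b i ⊆ O := by
    obtain ⟨S, hS, -, hSb⟩ := TopologicalSpace.exists_countable_basis X
    obtain ⟨b, hb⟩ := (hS.insert Set.univ).exists_eq_range (Set.insert_nonempty _ _)
    refine ⟨b, fun i ↦ ?_, fun x O hO hx ↦ ?_⟩
    · rcases hb ▸ Set.mem_range_self i with h | h
      · rw [h]
        exact isOpen_univ
      · exact hSb.isOpen h
    · obtain ⟨v, hv, hxv, hvO⟩ := hSb.exists_subset_of_mem_open hx hO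
      obtain ⟨i, rfl⟩ : v ∈ Set.range b := hb ▸ Set.mem_insert_of_mem _ hv
      exact ⟨i, hxv, hvO⟩
  obtain ⟨F, C, hFC, hCF, hbF⟩ := exists_seq_isCoverOver b hbo
  refine ⟨C, fun m ↦ (hFC m).finite, fun m ↦ (hFC m).isOpen, fun m c hc ↦ ?_, fun m x ↦ ?_,
    fun k m hkm q hq ↦ (hFC m).subsingleton q (hCF k m hkm hq), fun x O hO hx ↦ ?_⟩
  · obtain ⟨z, hz, h1, h2⟩ := (hFC m).exists_point c hc
    exact ⟨z, hz, h1, fun k hk q hq ↦ h2 q (hCF k m hk hq)⟩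
  · obtain ⟨c, hc, hx, h⟩ := (hFC m).exists_mem x
    exact ⟨c, hc, hx, fun k hk q hq ↦ h q (hCF k m hk hq)⟩
  · have : ∀ y, ∃ i, y ∈ b i ∧ (x ∈ b i → b i ⊆ O) := fun y ↦ by
      by_cases hy : y = x
      · obtain ⟨i, hi, hiO⟩ := hb x O hO hx
        exact ⟨i, hy ▸ hi, fun _ ↦ hiO⟩
      · obtain ⟨i, hi, hix⟩ := hb y {x}ᶜ isOpen_compl_singleton hy
        exact ⟨i, hi, fun h ↦ absurd rfl (hix h)⟩
    choose i hi hix using this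
    obtain ⟨t, ht⟩ := isCompact_univ.elim_finite_subcover (fun y ↦ b (i y)) (fun y ↦ hbo _)
      fun y _ ↦ Set.mem_iUnion.2 ⟨y, hi y⟩
    refine ⟨t.sup i, fun m hm c hc hxc ↦ ?_⟩
    obtain ⟨z, -, -, hz⟩ := (hFC m).exists_point c hc
    obtain ⟨y, hy, hzy⟩ := Set.mem_iUnion₂.1 (ht (Set.mem_univ z))
    have hcy := hz _ (hbF _ _ ((Finset.le_sup hy).trans hm)) hzy
    exact hcy.trans (hix y (hcy hxc))

namespace IsLevelSequence

variable {X : Type*} [TopologicalSpace X] {C : ℕ → Set (Set X)}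

lemma exists_superset (h : IsLevelSequence C) {k m : ℕ} (hkm : k ≤ m) {c : Set X}
    (hc : c ∈ C m) : ∃ q ∈ C k, c ⊆ q := by
  rcases hkm.eq_or_lt with rfl | hlt
  · exact ⟨c, hc, Set.Subset.rfl⟩
  · obtain ⟨z, -, -, hz⟩ := h.exists_point m c hc
    obtain ⟨q, hq, hzq, -⟩ := h.exists_mem k z
    exact ⟨q, hq, hz k hlt q hq hzq⟩

/-- Every element of a cover has a point at which comparability with any other element of the
sequence is decided. -/
lemma exists_point_subset (h : IsLevelSequence C) {m : ℕ} {c : Set X} (hc : c ∈ C m) :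
    ∃ z ∈ c, ∀ k, ∀ q ∈ C k, z ∈ q → (k ≤ m → c ⊆ q) ∧ (m ≤ k → q ⊆ c) := by
  obtain ⟨z, hz, hpriv, hlt⟩ := h.exists_point m c hc
  refine ⟨z, hz, fun k q hq hzq ↦ ⟨fun hkm ↦ ?_, fun hmk ↦ ?_⟩⟩
  · rcases hkm.eq_or_lt with rfl | hkm
    · exact (hpriv q hq hzq).symm.subset
    · exact hlt k hkm q hq hzq
  · obtain ⟨d, hd, hqd⟩ := h.exists_superset hmk hq
    exact hpriv d hd (hqd hzq) ▸ hqd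

lemma eq_of_subset (h : IsLevelSequence C) {k m : ℕ} (hmk : m ≤ k) {c q : Set X} (hc : c ∈ C m)
    (hq : q ∈ C k) (hcq : c ⊆ q) : c = q := by
  obtain ⟨z, hz, hzq⟩ := h.exists_point_subset hc
  exact hcq.antisymm ((hzq k q hq (hcq hz)).2 hmk)

lemma level_unique (h : IsLevelSequence C) {k m : ℕ} {q : Set X} (hq : q.Nontrivial)
    (hk : q ∈ C k) (hm : q ∈ C m) : k = m := by
  rcases lt_trichotomy k m with hlt | rfl | hlt
  · exact absurd (h.subsingleton k m hlt q hk q hm Set.Subset.rfl) hq.not_subsingleton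
  · rfl
  · exact absurd (h.subsingleton m k hlt q hm q hk Set.Subset.rfl) hq.not_subsingleton

lemma nontrivial_of_ssubset (h : IsLevelSequence C) {m : ℕ} {c q : Set X} (hc : c ∈ C m)
    (hcq : c ⊂ q) : q.Nontrivial := by
  obtain ⟨z, hz, -⟩ := h.exists_point m c hc
  obtain ⟨y, hy, hyc⟩ := Set.exists_of_ssubset hcq
  exact ⟨z, hcq.subset hz, y, hy, fun hzy ↦ hyc (hzy ▸ hz)⟩

lemma nonempty (h : IsLevelSequence C) {m : ℕ} {c : Set X} (hc : c ∈ C m) : c.Nonempty :=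
  (h.exists_point m c hc).imp fun _ hz ↦ hz.1

lemma isNeBasis (h : IsLevelSequence C) : IsNeBasis (⋃ m, C m) := by
  refine ⟨TopologicalSpace.isTopologicalBasis_of_isOpen_of_nhds (fun u hu ↦ ?_)
    fun x O hx hO ↦ ?_, fun p hp ↦ ?_⟩
  · obtain ⟨m, hm⟩ := Set.mem_iUnion.1 hu
    exact h.isOpen m u hm
  · obtain ⟨M, hM⟩ := h.small x O hO hx
    obtain ⟨c, hc, hxc, -⟩ := h.exists_mem M x
    exact ⟨c, Set.mem_iUnion.2 ⟨M, hc⟩, hxc, hM M le_rfl c hc hxc⟩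
  · obtain ⟨m, hm⟩ := Set.mem_iUnion.1 hp
    exact h.nonempty hm

lemma isBandBasis [T1Space X] (h : IsLevelSequence C) : IsBandBasis (⋃ m, C m) := by
  refine ⟨h.isNeBasis, fun B ↦ and_congr_right fun hfin ↦ ⟨fun hB ↦ ?_, fun hB p ↦ ?_⟩⟩
  · refine Set.eq_univ_of_forall fun x ↦ ?_
    by_contra hx
    simp only [Set.mem_iUnion, not_exists] at hx
    have : ∀ b : ↥(⋃ m, C m), ∃ M, b ∈ B → ∀ m ≥ M, ∀ c ∈ C m, x ∈ c → ¬ (b : Set X) ⊆ c := by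
      intro b
      by_cases hb : b ∈ B
      · obtain ⟨y, hy⟩ := h.isNeBasis.2 b b.2
        obtain ⟨M, hM⟩ := h.small x {y}ᶜ isOpen_compl_singleton fun hxy ↦ hx b hb (hxy ▸ hy)
        exact ⟨M, fun _ m hm c hc hxc hbc ↦ hM m hm c hc hxc (hbc hy) rfl⟩
      · exact ⟨0, fun hb' ↦ absurd hb' hb⟩
    choose M hM using this
    obtain ⟨c, hc, hxc, -⟩ := h.exists_mem (hfin.toFinset.sup M) x
    obtain ⟨b, hb, hcb | hbc⟩ := hB ⟨c, Set.mem_iUnion.2 ⟨_, hc⟩⟩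
    · exact hx b hb (hcb hxc)
    · exact hM b hb _ (Finset.le_sup (hfin.mem_toFinset.2 hb)) c hc hxc hbc
  · obtain ⟨m, hm⟩ := Set.mem_iUnion.1 p.2
    obtain ⟨z, -, hz⟩ := h.exists_point_subset hm
    obtain ⟨b, hb, hzb⟩ := Set.mem_iUnion₂.1 (hB.symm ▸ Set.mem_univ z)
    obtain ⟨k, hk⟩ := Set.mem_iUnion.1 b.2
    have hzk := hz k b hk hzb
    exact ⟨b, hb, (le_total k m).imp hzk.1 hzk.2⟩

lemma isGrading (h : IsLevelSequence C) :
    IsGrading fun p : ↥(⋃ m, C m) ↦ sInf {m | (p : Set X) ∈ C m} := by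
  have hmem : ∀ p : ↥(⋃ m, C m), (p : Set X) ∈ C (sInf {m | (p : Set X) ∈ C m}) :=
    fun p ↦ Nat.sInf_mem (Set.mem_iUnion.1 p.2)
  have hnot : ∀ p : ↥(⋃ m, C m), ∀ k < sInf {m | (p : Set X) ∈ C m}, (p : Set X) ∉ C k :=
    fun p k hk ↦ Nat.notMem_of_lt_sInf hk
  have hlev : ∀ (p q : ↥(⋃ m, C m)) (k : ℕ), p < q → (q : Set X) ∈ C k →
      sInf {m | (q : Set X) ∈ C m} = k := fun p q k hpq hq ↦
    h.level_unique (h.nontrivial_of_ssubset (hmem p) hpq) (hmem q) hq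
  refine ⟨fun p q hpq ↦ ?_, fun p hp ↦ ?_, fun p q hpq hlt ↦ ?_⟩
  · by_contra hle
    exact hpq.ne (Subtype.ext (h.eq_of_subset (not_lt.1 hle) (hmem p) (hmem q) hpq.le))
  · obtain ⟨n, hn⟩ := Nat.exists_eq_succ_of_ne_zero hp
    obtain ⟨q, hq, hpq⟩ := h.exists_superset (k := n) (hn ▸ n.le_succ) (hmem p)
    have hlt : p < ⟨q, Set.mem_iUnion.2 ⟨n, hq⟩⟩ := lt_of_le_of_ne hpq fun heq ↦
      hnot p n (by rw [hn]; exact n.lt_succ_self) (by rw [heq]; exact hq)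
    exact ⟨_, hlt, by simp only [hlev _ _ n hlt hq, hn]⟩
  · obtain ⟨n, hn⟩ := Nat.exists_eq_succ_of_ne_zero (Nat.ne_zero_of_lt hlt)
    obtain ⟨z, hz, -, hzp⟩ := h.exists_point _ _ (hmem p)
    obtain ⟨c, hc, hzc, hcq⟩ := h.exists_mem n z
    have hnp : n < sInf {m | (p : Set X) ∈ C m} := by rw [hn]; exact n.lt_succ_self
    have hqn : sInf {m | (q : Set X) ∈ C m} < n := by
      exact Nat.succ_lt_succ_iff.1 (hn ▸ hlt)
    refine ⟨⟨c, Set.mem_iUnion.2 ⟨n, hc⟩⟩, lt_of_le_of_ne (hzp n hnp c hc hzc) fun heq ↦ ?_,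
      lt_of_le_of_ne (hcq _ hqn q (hmem q) (hpq.le hz)) fun heq ↦ ?_⟩
    · exact hnot p n hnp (by rw [heq]; exact hc)
    · exact hqn.ne (hlev p q n hpq (by rw [← heq]; exact hc))

lemma isOmegaPoset (h : IsLevelSequence C) : IsOmegaPoset ↥(⋃ m, C m) := by
  refine h.isGrading.isOmegaPoset fun n ↦ ?_
  have hfin : (⋃ m ∈ Set.Iic n, C m).Finite :=
    (Set.finite_Iic n).biUnion fun m _ ↦ h.finite m
  refine (hfin.preimage Subtype.val_injective.injOn).subset fun p hp ↦ ?_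
  exact Set.mem_iUnion₂.2 ⟨_, hp, Nat.sInf_mem (Set.mem_iUnion.1 p.2)⟩

end IsLevelSequence

/-- Every second countable compact T1 space has a graded ω-band-basis. -/
theorem exists_graded_omegaBandBasis {X : Type*} [TopologicalSpace X]
    [SecondCountableTopology X] [CompactSpace X] [T1Space X] :
    ∃ P : Set (Set X), IsBandBasis P ∧ IsOmegaPoset ↥P ∧ GradedPoset ↥P := by
  obtain ⟨C, hC⟩ := exists_isLevelSequence X
  exact ⟨⋃ m, C m, hC.isBandBasis, hC.isOmegaPoset, hC.isGrading.gradedPoset⟩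
end

section
/- For any ω-poset P: if P is branching and predetermined then P is cap-determined, and if P is cap-determined then P is branching. -/
/-- In an ω-poset only finitely many principal filters have at most `n` elements. -/
theorem IsOmegaPoset.finite_setOf_ncard_Ici_le {α : Type*} [PartialOrder α]
    (h : IsOmegaPoset α) (n : ℕ) : {x : α | (Set.Ici x).ncard ≤ n}.Finite := by
  refine ((Set.finite_Iic n).biUnion fun k _ => h.2 k).subset fun x hx => ?_
  simpa using hx

/-- Every element of an ω-poset admits a band none of whose members lies strictly above it. -/
theorem IsOmegaPoset.exists_isBand_forall_not_lt {α : Type*} [PartialOrder α]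
    (h : IsOmegaPoset α) (r : α) : ∃ B : Set α, IsBand B ∧ ∀ b ∈ B, ¬ r < b := by
  set V : Set α := {x | Set.Ioi x ⊆ Set.Ici r}
  have hfin : V.Finite := by
    refine (h.finite_setOf_ncard_Ici_le ((Set.Ici r).ncard + 1)).subset fun x hx => ?_
    have hsub : Set.Ici x ⊆ insert x (Set.Ici r) := by
      rw [← Set.Ioi_insert]
      exact Set.insert_subset_insert hx
    exact (Set.ncard_le_ncard hsub ((h.1 r).insert x)).trans (Set.ncard_insert_le _ _)
  have hrV : r ∈ V := fun _ hy => le_of_lt hy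
  refine ⟨{b | Minimal (· ∈ V) b}, ⟨hfin.subset fun b hb => hb.prop, fun x => ?_⟩,
    fun b hb hlt => hb.not_lt hrV hlt⟩
  by_cases hx : x ∈ V
  · obtain ⟨b, hbx, hb⟩ := hfin.exists_le_minimal hx
    exact ⟨b, hb, Or.inr hbx⟩
  · have hxr : ¬ r ≤ x := fun hrx => hx fun y hy => hrx.trans (le_of_lt hy)
    obtain ⟨m, hxm, hm⟩ := ((h.1 x).inter_of_left {y | ¬ r ≤ y}).exists_le_maximal
      (⟨le_rfl, hxr⟩ : x ∈ Set.Ici x ∩ {y | ¬ r ≤ y})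
    refine ⟨m, ⟨fun y hy => ?_, fun y hy hym => ?_⟩, Or.inl hxm⟩
    · by_contra hry
      exact hm.not_gt ⟨hxm.trans (le_of_lt hy), hry⟩ hy
    · by_contra hmy
      exact hm.prop.2 (hy (lt_of_le_not_ge hym hmy))

/-- The elements below `r` all of whose upper bounds are comparable with `r`. -/
def nodesBelow {α : Type*} [PartialOrder α] (r : α) : Set α :=
  {c | c ≤ r ∧ ∀ y, c ≤ y → y ≤ r ∨ r ≤ y}

theorem self_mem_nodesBelow {α : Type*} [PartialOrder α] (r : α) : r ∈ nodesBelow r :=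
  ⟨le_rfl, fun _ hy => Or.inr hy⟩

/-- In a predetermined ω-poset, every finite set `B` has a member of `nodesBelow r`
with no element of `B` strictly below it. -/
theorem IsOmegaPoset.exists_mem_nodesBelow_forall_not_lt {α : Type*} [PartialOrder α]
    (h : IsOmegaPoset α) (hP : Predetermined α) (r : α) {B : Set α} (hB : B.Finite) :
    ∃ c ∈ nodesBelow r, ∀ b ∈ B, ¬ b < c := by
  have hfin : (nodesBelow r ∩ ⋃ b ∈ B, Set.Ici b).Finite :=
    (hB.biUnion fun b _ => h.1 b).subset Set.inter_subset_right
  by_cases hr : r ∈ nodesBelow r ∩ ⋃ b ∈ B, Set.Ici b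
  · obtain ⟨c, -, hc⟩ := hfin.exists_le_minimal hr
    by_cases hmin : IsMin c
    · exact ⟨c, hc.prop.1, fun b _ => hmin.not_lt⟩
    · obtain ⟨d, hdc, hd⟩ := hP c hmin
      have hdr : d ∈ nodesBelow r := by
        refine ⟨hdc.le.trans hc.prop.1.1, fun y hy => ?_⟩
        rcases hy.eq_or_lt with rfl | hy
        · exact Or.inl (hdc.le.trans hc.prop.1.1)
        · exact hc.prop.1.2 y (hd y hy)
      refine ⟨d, hdr, fun b hb hbd => hc.not_lt ⟨hdr, ?_⟩ hdc⟩
      exact Set.mem_biUnion hb hbd.le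
  · exact ⟨r, self_mem_nodesBelow r, fun b hb hbr =>
      hr ⟨self_mem_nodesBelow r, Set.mem_biUnion hb hbr.le⟩⟩

/-- In a predetermined ω-poset, the elements lying above no member of `nodesBelow r`
do not form a cap. -/
theorem IsOmegaPoset.not_isCap_setOf_not_le {α : Type*} [PartialOrder α]
    (h : IsOmegaPoset α) (hP : Predetermined α) (r : α) :
    ¬ IsCap {x | ∀ c ∈ nodesBelow r, ¬ c ≤ x} := by
  rintro ⟨B, hB, hBF⟩
  obtain ⟨c, hc, hcB⟩ := h.exists_mem_nodesBelow_forall_not_lt hP r hB.1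
  obtain ⟨b, hb, hcb⟩ := hB.2 c
  have hle : c ≤ b := by
    rcases hcb with hcb | hbc
    · exact hcb
    · exact (hbc.eq_of_not_lt (hcB b hb)).ge
  obtain ⟨f, hf, hbf⟩ := hBF b hb
  exact hf c hc (hle.trans hbf)

theorem IsOmegaPoset.capDetermined {α : Type*} [PartialOrder α]
    (h : IsOmegaPoset α) (hbr : Branching α) (hP : Predetermined α) : CapDetermined α := by
  intro p q hpq
  by_contra hle
  obtain ⟨r, hrp, hrq, hqr⟩ : ∃ r, r ≤ p ∧ ¬ r ≤ q ∧ ¬ q ≤ r := by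
    by_cases hqp : q ≤ p
    · obtain ⟨r, hr⟩ := hbr q p (lt_of_le_not_ge hqp hle)
      exact ⟨r, hr.1.le, hr.2⟩
    · exact ⟨p, le_rfl, hle, hqp⟩
  refine h.not_isCap_setOf_not_le hP r ?_
  have hq : q ∈ {x | ∀ c ∈ nodesBelow r, ¬ c ≤ x} := fun c hc hcq =>
    (hc.2 q hcq).elim hqr hrq
  have hcap := hpq {x | ∀ c ∈ nodesBelow r, ¬ c ≤ x} ?_
  · rwa [Set.union_eq_self_of_subset_right (Set.singleton_subset_iff.2 hq)] at hcap
  obtain ⟨B, hB, hBr⟩ := h.exists_isBand_forall_not_lt r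
  refine ⟨B, hB, fun b hb => ?_⟩
  by_cases hbF : b ∈ {x | ∀ c ∈ nodesBelow r, ¬ c ≤ x}
  · exact ⟨b, Or.inl hbF, le_rfl⟩
  · simp only [Set.mem_ofPred_eq, not_forall, not_not] at hbF
    obtain ⟨c, hc, hcb⟩ := hbF
    refine ⟨p, Or.inr rfl, ?_⟩
    rcases hc.2 b hcb with hbr | hrb
    · exact hbr.trans hrp
    · exact (hrb.eq_of_not_lt (hBr b hb)).ge.trans hrp

/-- If every element strictly below `q` is comparable with `p < q`, then `q ≾ p`. -/
theorem capBelow_of_forall_lt_comparable {α : Type*} [PartialOrder α] {p q : α} (hpq : p < q)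
    (hcomp : ∀ r < q, r ≤ p ∨ p ≤ r) : CapBelow q p := by
  rintro F ⟨B, hB, hBF⟩
  have hcomp' : ∀ r ≤ q, r ≤ p ∨ p ≤ r := fun r hr =>
    hr.eq_or_lt.elim (fun e => Or.inr (e ▸ hpq.le)) (hcomp r)
  refine ⟨insert p (B \ Set.Icc p q), ⟨(hB.1.sdiff).insert p, fun x => ?_⟩, ?_⟩
  · obtain ⟨b, hb, hxb⟩ := hB.2 x
    by_cases hbI : b ∈ Set.Icc p q
    · refine ⟨p, Set.mem_insert _ _, ?_⟩
      rcases hxb with hxb | hbx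
      · exact hcomp' x (hxb.trans hbI.2)
      · exact Or.inr (hbI.1.trans hbx)
    · exact ⟨b, Or.inr ⟨hb, hbI⟩, hxb⟩
  · rintro b (rfl | ⟨hb, hbI⟩)
    · exact ⟨b, Or.inr rfl, le_rfl⟩
    · obtain ⟨f, hf | rfl, hbf⟩ := hBF b hb
      · exact ⟨f, Or.inl hf, hbf⟩
      · exact ⟨p, Or.inr rfl, (hcomp' b hbf).resolve_right fun hpb => hbI ⟨hpb, hbf⟩⟩

theorem CapDetermined.branching {α : Type*} [PartialOrder α] (h : CapDetermined α) :
    Branching α := by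
  intro p q hpq
  by_contra! hcomp
  refine hpq.not_ge (h q p (capBelow_of_forall_lt_comparable hpq fun r hr => ?_))
  exact or_iff_not_imp_left.2 (hcomp r hr)

/-- For ω-posets, branching and predetermined implies cap-determined,
and cap-determined implies branching. -/
theorem branching_predetermined_capDetermined {α : Type*} [PartialOrder α]
    (h : IsOmegaPoset α) :
    (Branching α ∧ Predetermined α → CapDetermined α) ∧
    (CapDetermined α → Branching α) :=
  ⟨fun hα => h.capDetermined hα.1 hα.2, CapDetermined.branching⟩
end

section
/- For any poset P: every selector of P contains a minimal selector, and every minimal selector of P is an up-set (upward closed under ≤). -/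
theorem IsCap.exists_finite_subset {α : Type*} [PartialOrder α] {C : Set α} (hC : IsCap C) :
    ∃ F ⊆ C, F.Finite ∧ IsCap F := by
  obtain ⟨B, hB, hBC⟩ := hC
  choose! f hfC hf using hBC
  exact ⟨f '' B, Set.image_subset_iff.2 hfC, hB.1.image f, B, hB,
    fun b hb => ⟨f b, Set.mem_image_of_mem f hb, hf b hb⟩⟩

theorem IsCap.of_refines {α : Type*} [PartialOrder α] {C D : Set α} (hC : IsCap C)
    (hCD : Refines C D) : IsCap D := by
  obtain ⟨B, hB, hBC⟩ := hC
  refine ⟨B, hB, fun b hb => ?_⟩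
  obtain ⟨c, hc, hbc⟩ := hBC b hb
  obtain ⟨d, hd, hcd⟩ := hCD c hc
  exact ⟨d, hd, hbc.trans hcd⟩

theorem IsChain.exists_mem_disjoint_of_finite {α : Type*} {c : Set (Set α)}
    (hc : IsChain (· ⊆ ·) c) (hne : c.Nonempty) {F : Set α} (hF : F.Finite)
    (h : ∀ x ∈ F, x ∉ ⋂₀ c) : ∃ S ∈ c, Disjoint S F := by
  induction F, hF using Set.Finite.induction_on with
  | empty => exact ⟨hne.some, hne.some_mem, Set.disjoint_empty _⟩
  | @insert a F _ _ ih =>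
    obtain ⟨S, hS, hSF⟩ := ih fun x hx => h x (Set.mem_insert_of_mem a hx)
    have ha := h a (Set.mem_insert a F)
    simp only [Set.mem_sInter, not_forall] at ha
    obtain ⟨T, hT, haT⟩ := ha
    rcases hc.total hS hT with hST | hTS
    · exact ⟨S, hS, Set.disjoint_insert_right.2 ⟨fun haS => haT (hST haS), hSF⟩⟩
    · exact ⟨T, hT, Set.disjoint_insert_right.2 ⟨haT, hSF.mono_left hTS⟩⟩

theorem IsSelector.sInter {α : Type*} [PartialOrder α] {c : Set (Set α)}
    (hc : IsChain (· ⊆ ·) c) (hne : c.Nonempty) (hsel : ∀ S ∈ c, IsSelector S) :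
    IsSelector (⋂₀ c) := by
  intro C hC
  obtain ⟨F, hFC, hF, hFcap⟩ := hC.exists_finite_subset
  by_contra hempty
  obtain ⟨S, hS, hSF⟩ := hc.exists_mem_disjoint_of_finite hne hF
    fun x hx hxc => hempty ⟨x, hxc, hFC hx⟩
  exact Set.not_disjoint_iff_nonempty_inter.2 (hsel S hS F hFcap) hSF

theorem IsSelector.exists_isMinSelector_subset {α : Type*} [PartialOrder α] {S : Set α}
    (hS : IsSelector S) : ∃ T ⊆ S, IsMinSelector T := by
  obtain ⟨T, hTS, hT⟩ := zorn_superset_nonempty {S : Set α | IsSelector S}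
    (fun c hsel hc hne =>
      ⟨⋂₀ c, IsSelector.sInter hc hne hsel, fun _ => Set.sInter_subset_of_mem⟩) S hS
  exact ⟨T, hTS, hT.prop, fun U hUT hU => hUT.antisymm (hT.le_of_le hU hUT)⟩

theorem IsMinSelector.isUpperSet {α : Type*} [PartialOrder α] {S : Set α}
    (hS : IsMinSelector S) : IsUpperSet S := by
  intro p q hpq hp
  have hnot : ¬ IsSelector (S \ {p}) := fun h =>
    ((hS.2 _ Set.sdiff_subset h).symm ▸ hp : p ∈ S \ {p}).2 rfl
  simp only [IsSelector, not_forall] at hnot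
  obtain ⟨C, hC, hSC⟩ := hnot
  have hD : IsCap (insert q (C \ {p})) := hC.of_refines fun x hx => by
    rcases eq_or_ne x p with rfl | hxp
    · exact ⟨q, Set.mem_insert _ _, hpq⟩
    · exact ⟨x, Set.mem_insert_of_mem _ ⟨hx, hxp⟩, le_rfl⟩
  obtain ⟨s, hsS, rfl | hs⟩ := hS.1 _ hD
  · exact hsS
  · exact absurd ⟨s, ⟨hsS, hs.2⟩, hs.1⟩ hSC

/-- Every selector contains a minimal selector, and every minimal
selector is an up-set. -/
theorem selectors_and_minimal_selectors {α : Type*} [PartialOrder α] :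
    (∀ S : Set α, IsSelector S → ∃ T : Set α, T ⊆ S ∧ IsMinSelector T) ∧
    (∀ S : Set α, IsMinSelector S → ∀ p ∈ S, ∀ q : α, p ≤ q → q ∈ S) :=
  ⟨fun _ hS => hS.exists_isMinSelector_subset,
    fun _ hS _ hp _ hpq => hS.isUpperSet hpq hp⟩
end

section
/- If P is a cap-basis of a T1 topological space X (ordered by inclusion), then the map x ↦ x^∈ = {p ∈ P : x ∈ p} is a homeomorphism from X onto the spectrum SP. -/
theorem IsCapBasis.isMinSelector_setOf_mem {X : Type*} [TopologicalSpace X] [T1Space X]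
    {P : Set (Set X)} (hP : IsCapBasis P) (x : X) :
    IsMinSelector {p : ↥P | x ∈ (p : Set X)} := by
  refine ⟨fun C hC => ?_, fun T hT hTsel => hT.antisymm fun p hp => ?_⟩
  · have hx : x ∈ ⋃ c ∈ C, (c : Set X) := (hP.2 C).1 hC ▸ Set.mem_univ x
    obtain ⟨c, hc, hxc⟩ := Set.mem_iUnion₂.1 hx
    exact ⟨c, hxc, hc⟩
  · -- By T1, `p` together with the basic sets avoiding `x` covers the space.
    have hcap : IsCap {q : ↥P | q = p ∨ x ∉ (q : Set X)} := by
      refine (hP.2 _).2 (Set.eq_univ_of_forall fun y => Set.mem_iUnion₂.2 ?_)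
      by_cases hyx : y = x
      · exact ⟨p, Or.inl rfl, hyx ▸ hp⟩
      · obtain ⟨q, hq, hyq, hqx⟩ := hP.1.1.exists_subset_of_mem_open
          (show y ∈ ({x} : Set X)ᶜ from hyx) isOpen_compl_singleton
        exact ⟨⟨q, hq⟩, Or.inr fun hxq => hqx hxq rfl, hyq⟩
    obtain ⟨q, hqT, rfl | hxq⟩ := hTsel _ hcap
    · exact hqT
    · exact absurd (hT hqT) hxq

theorem IsCapBasis.exists_eq_setOf_mem {X : Type*} [TopologicalSpace X] [T1Space X]
    {P : Set (Set X)} (hP : IsCapBasis P) {S : Set ↥P} (hS : IsMinSelector S) :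
    ∃ x : X, {p : ↥P | x ∈ (p : Set X)} = S := by
  have hcap : ¬ IsCap Sᶜ := fun h => by
    obtain ⟨q, hq, hq'⟩ := hS.1 _ h
    exact hq' hq
  rw [hP.2, Set.eq_univ_iff_forall, not_forall] at hcap
  obtain ⟨x, hx⟩ := hcap
  refine ⟨x, hS.2 _ (fun p hp => ?_) (hP.isMinSelector_setOf_mem x).1⟩
  by_contra hpS
  exact hx (Set.mem_iUnion₂.2 ⟨p, hpS, hp⟩)

/-- The map sending a point to the minimal selector of basic sets containing it. -/
def IsCapBasis.toSpectrum {X : Type*} [TopologicalSpace X] [T1Space X]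
    {P : Set (Set X)} (hP : IsCapBasis P) (x : X) : Spectrum ↥P :=
  ⟨{p : ↥P | x ∈ (p : Set X)}, hP.isMinSelector_setOf_mem x⟩

theorem IsCapBasis.toSpectrum_bijective {X : Type*} [TopologicalSpace X] [T1Space X]
    {P : Set (Set X)} (hP : IsCapBasis P) : Function.Bijective hP.toSpectrum := by
  refine ⟨fun x y hxy => ?_, fun S => ?_⟩
  · by_contra hne
    obtain ⟨q, hq, hxq, hqy⟩ := hP.1.1.exists_subset_of_mem_open
      (show x ∈ ({y} : Set X)ᶜ from hne) isOpen_compl_singleton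
    have hmem : (⟨q, hq⟩ : ↥P) ∈ (hP.toSpectrum y).1 := hxy ▸ hxq
    exact hqy hmem rfl
  · obtain ⟨x, hx⟩ := hP.exists_eq_setOf_mem S.2
    exact ⟨x, Subtype.ext hx⟩

theorem IsCapBasis.isInducing_toSpectrum {X : Type*} [TopologicalSpace X] [T1Space X]
    {P : Set (Set X)} (hP : IsCapBasis P) : Topology.IsInducing hP.toSpectrum := by
  refine ⟨hP.1.1.eq_generateFrom.trans ?_⟩
  refine Eq.trans ?_ induced_generateFrom_eq.symm
  congr 1
  ext U
  constructor
  · exact fun hU => ⟨_, ⟨⟨U, hU⟩, rfl⟩, rfl⟩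
  · rintro ⟨_, ⟨p, rfl⟩, rfl⟩
    exact p.2

/-- If `P` is a cap-basis of a T1 space `X` then `x ↦ x^∈` is a
homeomorphism from `X` onto the spectrum of `P`. -/
theorem capBasis_homeo_spectrum {X : Type*} [TopologicalSpace X] [T1Space X]
    (P : Set (Set X)) (hP : IsCapBasis P) :
    ∃ φ : X ≃ₜ Spectrum ↥P,
      ∀ (x : X) (p : ↥P), p ∈ (φ x).1 ↔ x ∈ (p : Set X) := by
  exact ⟨(Equiv.ofBijective _ hP.toSpectrum_bijective).toHomeomorphOfIsInducing
    hP.isInducing_toSpectrum, fun _ _ => Iff.rfl⟩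
end
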